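/- For every ε ∈ (0, 4/15) and every integer j ≥ 0 there exists a constant C = C(ε,j) > 0, and for every p ∈ (3,∞] there exists C_p > 0, such that the following holds. Let A ≥ 2 and let (u,π) be an axisymmetric classical solution of the Navier–Stokes equations on [0,1] with ‖u(t,·)‖_{L^{3,∞}(ℝ³)} ≤ A for all t ∈ [0,1]. Then for every t ∈ [1/2,1]: (i) ‖Dₓ^j u(t,x)‖ ≤ (r(x)^{−1−j} + r(x)^{−1/3+ε})·A^C for every x ∈ ℝ³ with r(x) > 0; and (ii) ‖u(t,·)‖_{L^p({x ∈ ℝ³ : r(x) ≥ 1})} ≤ A^{C_p}. -/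

import Mathlib

noncomputable section
open Real MeasureTheory Filter Metric Set
open scoped ENNReal NNReal Topology FourierTransform

/-- Three-dimensional Euclidean space. -/
abbrev E3 : Type := EuclideanSpace ℝ (Fin 3)

/-- The `i`-th partial derivative of a scalar function on `ℝ³`. -/
def pd (f : E3 → ℝ) (i : Fin 3) (x : E3) : ℝ :=
  fderiv ℝ f x (EuclideanSpace.single i 1)

/-- The Laplacian of a scalar function on `ℝ³`. -/
def lap (f : E3 → ℝ) (x : E3) : ℝ :=
  ∑ i : Fin 3, pd (fun y => pd f i y) i x

/-- `(u, pr)` is a classical solution of the Navier–Stokes equations on the time interval `I`. -/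
def IsNSSol (u : ℝ → E3 → E3) (pr : ℝ → E3 → ℝ) (I : Set ℝ) : Prop :=
  (ContDiff ℝ (⊤:ℕ∞) fun q : ℝ × E3 => u q.1 q.2) ∧
  (ContDiff ℝ (⊤:ℕ∞) fun q : ℝ × E3 => pr q.1 q.2) ∧
  (∀ t ∈ I, ∀ x : E3, ∀ i : Fin 3,
    deriv (fun s => u s x i) t - lap (fun y => u t y i) x
      + (∑ j : Fin 3, u t x j * pd (fun y => u t y i) j x) + pd (pr t) i x = 0) ∧
  (∀ t ∈ I, ∀ x : E3, (∑ i : Fin 3, pd (fun y => u t y i) i x) = 0)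

/-- Rotation by angle `θ` about the `x₃`-axis. -/
def rotZ (θ : ℝ) (x : E3) : E3 :=
  (WithLp.equiv 2 (Fin 3 → ℝ)).symm
    ![x 0 * Real.cos θ - x 1 * Real.sin θ, x 0 * Real.sin θ + x 1 * Real.cos θ, x 2]

/-- A time-dependent vector field is axisymmetric. -/
def AxiSym (u : ℝ → E3 → E3) : Prop := ∀ θ t x, u t (rotZ θ x) = rotZ θ (u t x)

/-- The weak `L^q` (quasi)norm `sup_{λ>0} λ · vol{|f| ≥ λ}^{1/q}`. -/
def wnorm' {F : Type*} [NormedAddCommGroup F] (f : E3 → F) (q : ℝ) : ℝ≥0∞ :=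
  ⨆ (l : ℝ) (_ : 0 < l), ENNReal.ofReal l * (volume {x : E3 | l ≤ ‖f x‖}) ^ (1 / q)

/-- The weak `L^3` norm. -/
def wnorm3 (f : E3 → E3) : ℝ≥0∞ := wnorm' f 3

/-- Distance to the `x₃`-axis. -/
def rr (x : E3) : ℝ := Real.sqrt (x 0 ^ 2 + x 1 ^ 2)

/-! ### Calculus of iterated partial derivatives -/

/-- Unit coordinate vectors. -/
abbrev ee (i : Fin 3) : E3 := EuclideanSpace.single i (1 : ℝ)

/-- Smooth scalar functions on `ℝ³`. -/
abbrev Sm (f : E3 → ℝ) : Prop := ContDiff ℝ (⊤ : ℕ∞) f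

/-- Jointly smooth families of scalar functions on `ℝ³`. -/
abbrev SmJ (H : ℝ → E3 → ℝ) : Prop := ContDiff ℝ (⊤ : ℕ∞) (fun q : ℝ × E3 => H q.1 q.2)

/-- Derivative of a family with respect to its parameter. -/
def dt (H : ℝ → E3 → ℝ) (b : ℝ) (y : E3) : ℝ := deriv (fun s => H s y) b

/-- Iterated partial derivatives along a list of indices. -/
def dL : List (Fin 3) → (E3 → ℝ) → E3 → ℝ
  | [], f => f
  | i :: l, f => pd (dL l f) i

/-- `g` vanishes outside the closed ball of radius `ρ` about `x`. -/
def Supp (x : E3) (ρ : ℝ) (g : E3 → ℝ) : Prop := ∀ y, y ∉ closedBall x ρ → g y = 0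

/-- Sum of the absolute values of all partial derivatives of order `n`. -/
def Nn : ℕ → (E3 → ℝ) → E3 → ℝ
  | 0, f, y => |f y|
  | n + 1, f, y => ∑ i : Fin 3, Nn n (pd f i) y

lemma SmJ.sm {H : ℝ → E3 → ℝ} (h : SmJ H) (b : ℝ) : Sm (H b) :=
  h.comp (contDiff_const.prodMk contDiff_id)

lemma Sm.diff {f : E3 → ℝ} (h : Sm f) : Differentiable ℝ f := h.differentiable (by simp)

lemma contDiff_dir {V : Type*} [NormedAddCommGroup V] [NormedSpace ℝ V] {F : V → ℝ}
    (h : ContDiff ℝ (⊤ : ℕ∞) F) (v : V) : ContDiff ℝ (⊤ : ℕ∞) (fun y => fderiv ℝ F y v) :=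
  (h.fderiv_right (m := (⊤ : ℕ∞)) (by simp)).clm_apply contDiff_const

lemma fderiv_dir_comm {V : Type*} [NormedAddCommGroup V] [NormedSpace ℝ V] {F : V → ℝ}
    (h : ContDiff ℝ (⊤ : ℕ∞) F) (x v w : V) :
    fderiv ℝ (fun y => fderiv ℝ F y v) x w = fderiv ℝ (fun y => fderiv ℝ F y w) x v := by
  have hd : Differentiable ℝ (fderiv ℝ F) :=
    (h.fderiv_right (m := (⊤ : ℕ∞)) (by simp)).differentiable (by simp)
  have h1 : ∀ u z : V, fderiv ℝ (fun y => fderiv ℝ F y u) x z = fderiv ℝ (fderiv ℝ F) x z u := by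
    intro u z
    rw [fderiv_clm_apply (hd x) (differentiableAt_const u)]
    simp
  rw [h1, h1]
  exact second_derivative_symmetric (fun y => ((h.differentiable (by simp)) y).hasFDerivAt)
    (hd x).hasFDerivAt _ _

lemma Sm.pd {f : E3 → ℝ} (h : Sm f) (i : Fin 3) : Sm (pd f i) := contDiff_dir h _

lemma Sm.lap {f : E3 → ℝ} (h : Sm f) : Sm (lap f) :=
  ContDiff.sum fun i _ => (h.pd i).pd i

lemma Sm.dL {f : E3 → ℝ} (h : Sm f) (l : List (Fin 3)) : Sm (dL l f) := by
  induction l with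
  | nil => exact h
  | cons i l ih => exact ih.pd i

lemma pd_eq_joint {H : ℝ → E3 → ℝ} (h : SmJ H) (i : Fin 3) (b : ℝ) (y : E3) :
    pd (H b) i y = fderiv ℝ (fun q : ℝ × E3 => H q.1 q.2) (b, y) (0, ee i) := by
  have h1 : HasFDerivAt (H b)
      ((fderiv ℝ (fun q : ℝ × E3 => H q.1 q.2) (b, y)).comp
        (ContinuousLinearMap.inr ℝ ℝ E3)) y :=
    HasFDerivAt.comp (g := fun q : ℝ × E3 => H q.1 q.2) (f := fun y => (b, y)) y
      ((h.differentiable (by simp)) (b, y)).hasFDerivAt (hasFDerivAt_prodMk_right b y)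
  simp [pd, h1.fderiv]

lemma dt_eq_joint {H : ℝ → E3 → ℝ} (h : SmJ H) (b : ℝ) (y : E3) :
    dt H b y = fderiv ℝ (fun q : ℝ × E3 => H q.1 q.2) (b, y) (1, 0) := by
  have h1 : HasFDerivAt (fun s => H s y)
      ((fderiv ℝ (fun q : ℝ × E3 => H q.1 q.2) (b, y)).comp
        (ContinuousLinearMap.inl ℝ ℝ E3)) b :=
    HasFDerivAt.comp (g := fun q : ℝ × E3 => H q.1 q.2) (f := fun s => (s, y)) b
      ((h.differentiable (by simp)) (b, y)).hasFDerivAt (hasFDerivAt_prodMk_left b y)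
  simp [dt, h1.hasDerivAt.deriv]

lemma SmJ.hasDerivAt {H : ℝ → E3 → ℝ} (h : SmJ H) (b : ℝ) (y : E3) :
    HasDerivAt (fun s => H s y) (dt H b y) b := by
  have : ContDiff ℝ (⊤ : ℕ∞) (fun s => H s y) :=
    ContDiff.comp (g := fun q : ℝ × E3 => H q.1 q.2) h (contDiff_id.prodMk contDiff_const)
  exact (this.differentiable (by simp) b).hasDerivAt

lemma SmJ.pd {H : ℝ → E3 → ℝ} (h : SmJ H) (i : Fin 3) : SmJ (fun b => pd (H b) i) := by
  have : (fun q : ℝ × E3 => _root_.pd (H q.1) i q.2) =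
      fun q => fderiv ℝ (fun q : ℝ × E3 => H q.1 q.2) q (0, ee i) := by
    ext q; exact pd_eq_joint h i q.1 q.2
  unfold SmJ; rw [this]; exact contDiff_dir h _

lemma SmJ.dt {H : ℝ → E3 → ℝ} (h : SmJ H) : SmJ (dt H) := by
  have : (fun q : ℝ × E3 => _root_.dt H q.1 q.2) =
      fun q => fderiv ℝ (fun q : ℝ × E3 => H q.1 q.2) q (1, 0) := by
    ext q; exact dt_eq_joint h q.1 q.2
  unfold SmJ; rw [this]; exact contDiff_dir h _

lemma dt_pd {H : ℝ → E3 → ℝ} (h : SmJ H) (i : Fin 3) :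
    dt (fun b => pd (H b) i) = fun b => pd (dt H b) i := by
  ext b y
  rw [dt_eq_joint (h.pd i), pd_eq_joint h.dt i]
  have h1 : (fun q : ℝ × E3 => pd (H q.1) i q.2) =
      fun q => fderiv ℝ (fun q : ℝ × E3 => H q.1 q.2) q (0, ee i) := by
    ext q; exact pd_eq_joint h i q.1 q.2
  have h2 : (fun q : ℝ × E3 => dt H q.1 q.2) =
      fun q => fderiv ℝ (fun q : ℝ × E3 => H q.1 q.2) q (1, 0) := by
    ext q; exact dt_eq_joint h q.1 q.2
  rw [h1, h2]
  exact fderiv_dir_comm h _ _ _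

lemma SmJ.dL {H : ℝ → E3 → ℝ} (h : SmJ H) (l : List (Fin 3)) : SmJ (fun b => dL l (H b)) := by
  induction l with
  | nil => exact h
  | cons i l ih => exact ih.pd i

lemma SmJ.lap {H : ℝ → E3 → ℝ} (h : SmJ H) : SmJ (fun b => lap (H b)) :=
  ContDiff.sum fun i _ => (h.pd i).pd i

lemma dt_dL {H : ℝ → E3 → ℝ} (h : SmJ H) (l : List (Fin 3)) :
    dt (fun b => dL l (H b)) = fun b => dL l (dt H b) := by
  induction l with
  | nil => rfl
  | cons i l ih =>
    have := dt_pd (h.dL l) i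
    rw [ih] at this
    exact this

lemma pd_comm {f : E3 → ℝ} (h : Sm f) (i j : Fin 3) : pd (pd f i) j = pd (pd f j) i := by
  ext y; exact fderiv_dir_comm h y _ _

lemma pd_add {f g : E3 → ℝ} (hf : Sm f) (hg : Sm g) (i : Fin 3) :
    pd (fun y => f y + g y) i = fun y => pd f i y + pd g i y := by
  ext y; simp [pd, fderiv_fun_add (hf.diff y) (hg.diff y)]

lemma pd_sub {f g : E3 → ℝ} (hf : Sm f) (hg : Sm g) (i : Fin 3) :
    pd (fun y => f y - g y) i = fun y => pd f i y - pd g i y := by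
  ext y; simp [pd, fderiv_fun_sub (hf.diff y) (hg.diff y)]

lemma pd_const_mul {f : E3 → ℝ} (hf : Sm f) (c : ℝ) (i : Fin 3) :
    pd (fun y => c * f y) i = fun y => c * pd f i y := by
  ext y; simp [pd, fderiv_const_mul (hf.diff y)]

lemma pd_mul {f g : E3 → ℝ} (hf : Sm f) (hg : Sm g) (i : Fin 3) :
    pd (fun y => f y * g y) i = fun y => pd f i y * g y + f y * pd g i y := by
  ext y; simp [pd, fderiv_fun_mul (hf.diff y) (hg.diff y)]; ring

lemma pd_sum {ι : Type*} (s : Finset ι) {f : ι → E3 → ℝ} (hf : ∀ a, Sm (f a)) (i : Fin 3) :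
    pd (fun y => ∑ a ∈ s, f a y) i = fun y => ∑ a ∈ s, pd (f a) i y := by
  ext y; simp [pd, fderiv_fun_sum (fun a _ => (hf a).diff y)]

lemma Sm.lap_pd {f : E3 → ℝ} (h : Sm f) (i : Fin 3) :
    _root_.lap (_root_.pd f i) = _root_.pd (_root_.lap f) i := by
  unfold _root_.lap
  rw [pd_sum _ (fun j => (h.pd j).pd j)]
  ext y
  refine Finset.sum_congr rfl fun j _ => ?_
  change _root_.pd (_root_.pd (_root_.pd f i) j) j y = _root_.pd (_root_.pd (_root_.pd f j) j) i y
  rw [pd_comm h i j, pd_comm (h.pd j) i j]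

lemma dL_append (l m : List (Fin 3)) (f : E3 → ℝ) : dL (l ++ m) f = dL l (dL m f) := by
  induction l with
  | nil => rfl
  | cons i l ih => simp [dL, ih]

lemma dL_pd {f : E3 → ℝ} (h : Sm f) (l : List (Fin 3)) (i : Fin 3) :
    dL l (pd f i) = pd (dL l f) i := by
  induction l with
  | nil => rfl
  | cons j l ih => simp only [dL]; rw [ih, pd_comm (h.dL l)]

lemma dL_lap {f : E3 → ℝ} (h : Sm f) (l : List (Fin 3)) : lap (dL l f) = dL l (lap f) := by
  induction l with
  | nil => rfl
  | cons j l ih => simp only [dL]; rw [Sm.lap_pd (h.dL l), ih]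

lemma dL_comm {f : E3 → ℝ} (h : Sm f) (l m : List (Fin 3)) : dL l (dL m f) = dL m (dL l f) := by
  induction l with
  | nil => rfl
  | cons j l ih => simp only [dL]; rw [ih, dL_pd (h.dL l)]

lemma dL_add {f g : E3 → ℝ} (hf : Sm f) (hg : Sm g) (l : List (Fin 3)) :
    dL l (fun y => f y + g y) = fun y => dL l f y + dL l g y := by
  induction l with
  | nil => rfl
  | cons i l ih => simp only [dL]; rw [ih, pd_add (hf.dL l) (hg.dL l)]

lemma dL_const_mul {f : E3 → ℝ} (hf : Sm f) (c : ℝ) (l : List (Fin 3)) :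
    dL l (fun y => c * f y) = fun y => c * dL l f y := by
  induction l with
  | nil => rfl
  | cons i l ih => simp only [dL]; rw [ih, pd_const_mul (hf.dL l)]

lemma Supp.pd {x : E3} {ρ : ℝ} {g : E3 → ℝ} (h : Supp x ρ g) (i : Fin 3) :
    Supp x ρ (pd g i) := by
  intro y hy
  have : g =ᶠ[𝓝 y] fun _ => 0 := by
    filter_upwards [isClosed_closedBall.isOpen_compl.mem_nhds hy] with z hz using h z hz
  simp [_root_.pd, this.fderiv_eq]

lemma Supp.dL {x : E3} {ρ : ℝ} {g : E3 → ℝ} (h : Supp x ρ g) (l : List (Fin 3)) :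
    Supp x ρ (dL l g) := by
  induction l with
  | nil => exact h
  | cons i l ih => exact ih.pd i

lemma Supp.lap {x : E3} {ρ : ℝ} {g : E3 → ℝ} (h : Supp x ρ g) : Supp x ρ (lap g) := by
  intro y hy
  exact Finset.sum_eq_zero fun i _ => (h.pd i).pd i y hy

lemma Supp.hasCompactSupport {x : E3} {ρ : ℝ} {g : E3 → ℝ} (h : Supp x ρ g) :
    HasCompactSupport g :=
  HasCompactSupport.intro (isCompact_closedBall x ρ) h

lemma Supp.mul_left {x : E3} {ρ : ℝ} {g : E3 → ℝ} (h : Supp x ρ g) (f : E3 → ℝ) :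
    Supp x ρ (fun y => f y * g y) := fun y hy => by simp [h y hy]

lemma Supp.integrable {x : E3} {ρ : ℝ} {g : E3 → ℝ} (h : Supp x ρ g) (hg : Continuous g) :
    Integrable g := hg.integrable_of_hasCompactSupport h.hasCompactSupport

/-- Integration by parts against a compactly supported function. -/
lemma integral_mul_pd {x : E3} {ρ : ℝ} {f g : E3 → ℝ} (hf : Sm f) (hg : Sm g) (h : Supp x ρ g)
    (i : Fin 3) : ∫ y, f y * pd g i y = - ∫ y, pd f i y * g y :=
  integral_mul_fderiv_eq_neg_fderiv_mul_of_integrable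
    ((h.mul_left _).integrable ((hf.pd i).continuous.mul hg.continuous))
    (((h.pd i).mul_left _).integrable (hf.continuous.mul (hg.pd i).continuous))
    ((h.mul_left _).integrable (hf.continuous.mul hg.continuous))
    (fun y _ => hf.diff y) (fun y _ => hg.diff y)

lemma integral_mul_dL {x : E3} {ρ : ℝ} {f g : E3 → ℝ} (hf : Sm f) (hg : Sm g) (h : Supp x ρ g)
    (l : List (Fin 3)) :
    ∫ y, f y * dL l g y = (-1) ^ l.length * ∫ y, dL l f y * g y := by
  induction l generalizing f with
  | nil => simp [dL]
  | cons i l ih =>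
    simp only [dL, List.length_cons]
    rw [integral_mul_pd hf (hg.dL l) (h.dL l), ih (hf.pd i), dL_pd hf]
    ring

lemma norm_iteratedFDeriv_pd_le {f : E3 → ℝ} (h : Sm f) (n : ℕ) (i : Fin 3) (y : E3) :
    ‖iteratedFDeriv ℝ n (pd f i) y‖ ≤ ‖iteratedFDeriv ℝ (n + 1) f y‖ := by
  have h1 : pd f i = (ContinuousLinearMap.apply ℝ ℝ (ee i)) ∘ (fderiv ℝ f) := by
    ext z; simp [pd]
  rw [h1, ← norm_iteratedFDeriv_fderiv]
  have h2 : ‖ContinuousLinearMap.apply ℝ ℝ (ee i)‖ ≤ 1 := by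
    refine ContinuousLinearMap.opNorm_le_bound _ zero_le_one fun L => ?_
    simpa [ee] using L.le_opNorm (ee i)
  refine (ContinuousLinearMap.norm_iteratedFDeriv_comp_left (n := n) (N := n) _ ?_ le_rfl).trans ?_
  · exact ((h.fderiv_right (m := n) (by exact_mod_cast le_top))).contDiffAt
  · exact mul_le_of_le_one_left (norm_nonneg _) h2

lemma abs_dL_le {f : E3 → ℝ} (h : Sm f) (l : List (Fin 3)) (y : E3) :
    |dL l f y| ≤ ‖iteratedFDeriv ℝ l.length f y‖ := by
  induction l using List.reverseRecOn generalizing f with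
  | nil => simp [dL]
  | append_singleton l i ih =>
    rw [dL_append, List.length_append]
    exact (ih (h.pd i)).trans (norm_iteratedFDeriv_pd_le h _ i y)

lemma norm_iteratedFDeriv_le_Nn {f : E3 → ℝ} (h : Sm f) (n : ℕ) (y : E3) :
    ‖iteratedFDeriv ℝ n f y‖ ≤ Nn n f y := by
  induction n generalizing f with
  | zero => simp [Nn]
  | succ n ih =>
    rw [← norm_iteratedFDeriv_fderiv]
    let M : Fin 3 → (ℝ →L[ℝ] (E3 →L[ℝ] ℝ)) := fun i =>
      (ContinuousLinearMap.id ℝ ℝ).smulRight (EuclideanSpace.proj i : E3 →L[ℝ] ℝ)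
    have hM : ∀ i, ‖M i‖ ≤ 1 := by
      intro i
      refine ContinuousLinearMap.opNorm_le_bound _ zero_le_one fun c => ?_
      simp only [M, ContinuousLinearMap.smulRight_apply, ContinuousLinearMap.id_apply, one_mul,
        norm_smul]
      refine mul_le_of_le_one_right (norm_nonneg _) ?_
      refine ContinuousLinearMap.opNorm_le_bound _ zero_le_one fun z => ?_
      simpa using PiLp.norm_apply_le z i
    have h1 : fderiv ℝ f = fun z => ∑ i : Fin 3, (M i ∘ pd f i) z := by
      ext z v
      have hv : v = ∑ i : Fin 3, v i • ee i := by
        ext j; simp [ee, Fin.sum_univ_three]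
        fin_cases j <;> simp
      conv_lhs => rw [hv]
      simp [map_sum, M, pd, mul_comm]
    rw [h1, iteratedFDeriv_fun_sum_apply
      (fun i _ => ((M i).contDiff.comp ((h.pd i).of_le (by exact_mod_cast le_top))).contDiffAt)]
    refine (norm_sum_le _ _).trans (Finset.sum_le_sum fun i _ => ?_)
    refine (ContinuousLinearMap.norm_iteratedFDeriv_comp_left (n := n) (N := n) _
      ((h.pd i).of_le (by exact_mod_cast le_top)).contDiffAt le_rfl).trans ?_
    exact (mul_le_of_le_one_left (norm_nonneg _) (hM i)).trans (ih (h.pd i))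

lemma Nn_nonneg (n : ℕ) (f : E3 → ℝ) (y : E3) : 0 ≤ Nn n f y := by
  induction n generalizing f with
  | zero => exact abs_nonneg _
  | succ n ih => exact Finset.sum_nonneg fun i _ => ih _

lemma Nn_le {f : E3 → ℝ} {n : ℕ} {y : E3} {B : ℝ}
    (h : ∀ l : List (Fin 3), l.length = n → |dL l f y| ≤ B) : Nn n f y ≤ 3 ^ n * B := by
  induction n generalizing f with
  | zero => simpa [dL, Nn] using h [] rfl
  | succ n ih =>
    have : ∀ i ∈ Finset.univ, Nn n (pd f i) y ≤ 3 ^ n * B := fun i _ => ih fun l hl => by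
      have := h (l ++ [i]) (by simp [hl])
      rwa [dL_append] at this
    refine (Finset.sum_le_sum this).trans ?_
    simp [pow_succ]; linarith

lemma SmJ.continuous_Nn {H : ℝ → E3 → ℝ} (h : SmJ H) (n : ℕ) :
    Continuous (fun q : ℝ × E3 => Nn n (H q.1) q.2) := by
  induction n generalizing H with
  | zero => exact h.continuous.abs
  | succ n ih => exact continuous_finsetSum _ fun i _ => ih (h.pd i)

/-! ### The pressure-free weak formulation -/

/-- The `k`-th component of the divergence-free field `curl curl (g eᵢ)`. -/
def cc (g : E3 → ℝ) (i k : Fin 3) (y : E3) : ℝ :=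
  pd (pd g i) k y - (if k = i then 1 else 0) * lap g y

lemma Sm.cc {g : E3 → ℝ} (h : Sm g) (i k : Fin 3) : Sm (cc g i k) :=
  ((h.pd i).pd k).sub (contDiff_const.mul h.lap)

lemma Supp.cc {x : E3} {ρ : ℝ} {g : E3 → ℝ} (h : Supp x ρ g) (i k : Fin 3) :
    Supp x ρ (cc g i k) := fun y hy => by
  simp [_root_.cc, (h.pd i).pd k y hy, h.lap y hy]

lemma SmJ.cc {H : ℝ → E3 → ℝ} (h : SmJ H) (i k : Fin 3) : SmJ (fun b => cc (H b) i k) :=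
  ((h.pd i).pd k).sub (contDiff_const.mul h.lap)

lemma dt_lap {H : ℝ → E3 → ℝ} (h : SmJ H) :
    dt (fun b => lap (H b)) = fun b => lap (dt H b) := by
  ext b y
  have h1 : ∀ i, HasDerivAt (fun s => pd (pd (H s) i) i y) (pd (pd (dt H b) i) i y) b := by
    intro i
    have := ((h.pd i).pd i).hasDerivAt b y
    rwa [dt_pd (h.pd i), dt_pd h] at this
  exact (HasDerivAt.fun_sum fun i _ => h1 i).deriv

lemma hasDerivAt_cc {H : ℝ → E3 → ℝ} (h : SmJ H) (i k : Fin 3) (b : ℝ) (y : E3) :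
    HasDerivAt (fun s => cc (H s) i k y) (cc (dt H b) i k y) b := by
  have h1 := ((h.pd i).pd k).hasDerivAt b y
  rw [dt_pd (h.pd i), dt_pd h] at h1
  have h2 := h.lap.hasDerivAt b y
  rw [dt_lap h] at h2
  exact h1.sub (h2.const_mul _)

lemma pd_cc {g : E3 → ℝ} (h : Sm g) (i k j : Fin 3) :
    pd (cc g i k) j = fun y => pd (pd (pd g i) k) j y -
      (if k = i then 1 else 0) * pd (lap g) j y := by
  have : cc g i k = fun y => pd (pd g i) k y -
      (fun z => (if k = i then 1 else 0) * lap g z) y := rfl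
  rw [this, pd_sub ((h.pd i).pd k) (contDiff_const.mul h.lap), pd_const_mul h.lap]

lemma div_cc {g : E3 → ℝ} (h : Sm g) (i : Fin 3) (y : E3) : ∑ k, pd (cc g i k) k y = 0 := by
  have h1 : ∀ k, pd (cc g i k) k y
      = pd (pd (pd g i) k) k y - (if k = i then 1 else 0) * pd (lap g) k y := fun k => by
    rw [pd_cc h]
  simp only [h1, Finset.sum_sub_distrib, ite_mul, one_mul, zero_mul, Finset.sum_ite_eq',
    Finset.mem_univ, if_true]
  have : ∑ k, pd (pd (pd g i) k) k y = lap (pd g i) y := rfl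
  rw [this, Sm.lap_pd h, sub_self]

lemma lap_cc {g : E3 → ℝ} (h : Sm g) (i k : Fin 3) (y : E3) :
    lap (cc g i k) y = pd (lap (pd g i)) k y - (if k = i then 1 else 0) * lap (lap g) y := by
  have h1 : ∀ j, pd (pd (cc g i k) j) j y
      = pd (pd (pd (pd g i) k) j) j y -
        (if k = i then 1 else 0) * pd (pd (lap g) j) j y := fun j => by
    rw [pd_cc h]
    have : (fun y => pd (pd (pd g i) k) j y - (if k = i then 1 else 0) * pd (lap g) j y) =
      fun y => pd (pd (pd g i) k) j y -
        (fun z => (if k = i then 1 else 0) * pd (lap g) j z) y := rfl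
    rw [this, pd_sub (((h.pd i).pd k).pd j) (contDiff_const.mul (h.lap.pd j)),
      pd_const_mul (h.lap.pd j)]
  rw [← Sm.lap_pd (h.pd i)]
  change ∑ j, pd (pd (cc g i k) j) j y = _
  simp only [h1, Finset.sum_sub_distrib, ← Finset.mul_sum]
  rfl

lemma integral_pd_eq_zero {x : E3} {ρ : ℝ} {g : E3 → ℝ} (hg : Sm g) (h : Supp x ρ g) (i : Fin 3) :
    ∫ y, pd g i y = 0 := by
  have := integral_mul_pd (f := fun _ => (1 : ℝ)) contDiff_const hg h i
  simpa [pd] using this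

lemma integral_sum_pd_eq_zero {x : E3} {ρ : ℝ} {g : Fin 3 → E3 → ℝ} (hg : ∀ j, Sm (g j))
    (h : ∀ j, Supp x ρ (g j)) : ∫ y, ∑ j, pd (g j) j y = 0 := by
  rw [integral_finsetSum _ fun j _ => ((h j).pd j).integrable ((hg j).pd j).continuous]
  exact Finset.sum_eq_zero fun j _ => integral_pd_eq_zero (hg j) (h j) j

/-- A divergence-free field is orthogonal to gradients. -/
lemma integral_div_free {x : E3} {ρ : ℝ} {U : Fin 3 → E3 → ℝ} {ψ : E3 → ℝ} (hU : ∀ k, Sm (U k))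
    (hdiv : ∀ y, ∑ k, pd (U k) k y = 0) (hψ : Sm ψ) (h : Supp x ρ ψ) :
    ∫ y, ∑ k, U k y * pd ψ k y = 0 := by
  rw [← integral_sum_pd_eq_zero (g := fun k y => U k y * ψ y) (fun k => (hU k).mul hψ)
    (fun k => h.mul_left _)]
  congr 1; ext y
  have : ∀ k, pd (fun y => U k y * ψ y) k y = pd (U k) k y * ψ y + U k y * pd ψ k y := fun k => by
    rw [pd_mul (hU k) hψ]
  simp only [this, Finset.sum_add_distrib, ← Finset.sum_mul, hdiv, zero_mul, zero_add]

lemma integral_mul_cc {x : E3} {ρ : ℝ} {U : Fin 3 → E3 → ℝ} {g : E3 → ℝ} (hU : ∀ k, Sm (U k))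
    (hdiv : ∀ y, ∑ k, pd (U k) k y = 0) (hg : Sm g) (h : Supp x ρ g) (i : Fin 3) :
    ∫ y, ∑ k, U k y * cc g i k y = - ∫ y, U i y * lap g y := by
  have h0 := integral_div_free hU hdiv (hg.pd i) (h.pd i)
  have h1 : ∀ y, ∑ k, U k y * cc g i k y = ∑ k, U k y * pd (pd g i) k y - U i y * lap g y := by
    intro y
    simp only [cc, mul_sub, Finset.sum_sub_distrib]
    simp
  simp only [h1]
  rw [integral_sub, h0, zero_sub]
  · exact integrable_finsetSum _ fun k _ => (((h.pd i).pd k).mul_left _).integrable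
      ((hU k).continuous.mul ((hg.pd i).pd k).continuous)
  · exact (h.lap.mul_left _).integrable ((hU i).continuous.mul hg.lap.continuous)

/-- The Navier–Stokes momentum equation at a fixed time, tested against `curl curl (g eᵢ)`. -/
lemma momentum {x : E3} {ρ : ℝ} {U a : Fin 3 → E3 → ℝ} {q g : E3 → ℝ} (hU : ∀ k, Sm (U k))
    (hq : Sm q) (hdiv : ∀ y, ∑ k, pd (U k) k y = 0)
    (hns : ∀ y k, a k y - lap (U k) y + (∑ j, U j y * pd (U k) j y) + pd q k y = 0)
    (hg : Sm g) (h : Supp x ρ g) (i : Fin 3) :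
    ∫ y, ∑ k, a k y * cc g i k y =
      - (∫ y, U i y * lap (lap g) y) +
        ∫ y, ∑ k, ∑ j, U j y * U k y * pd (cc g i k) j y := by
  set φ := cc g i with hφ
  have sφ : ∀ k, Sm (φ k) := fun k => hg.cc i k
  have pφ : ∀ k, Supp x ρ (φ k) := fun k => h.cc i k
  let G : Fin 3 → E3 → ℝ := fun j y =>
    (∑ k, ((pd (U k) j y * φ k y - U k y * pd (φ k) j y) - U j y * U k y * φ k y)) - q y * φ j y
  have hG : ∀ j y, pd (G j) j y = (∑ k, ((pd (pd (U k) j) j y * φ k y - U k y * pd (pd (φ k) j) j y)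
      - (pd (U j) j y * U k y * φ k y + U j y * pd (U k) j y * φ k y
        + U j y * U k y * pd (φ k) j y))) - (pd q j y * φ j y + q y * pd (φ j) j y) := by
    intro j y
    have s1 : ∀ k, Sm (fun y => pd (U k) j y * φ k y) := fun k => ((hU k).pd j).mul (sφ k)
    have s2 : ∀ k, Sm (fun y => U k y * pd (φ k) j y) := fun k => (hU k).mul ((sφ k).pd j)
    have s3 : ∀ k, Sm (fun y => U j y * U k y) := fun k => (hU j).mul (hU k)
    have s4 : ∀ k, Sm (fun y => U j y * U k y * φ k y) := fun k => (s3 k).mul (sφ k)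
    have s5 : ∀ k, Sm (fun y => (pd (U k) j y * φ k y - U k y * pd (φ k) j y)
      - U j y * U k y * φ k y) := fun k => ((s1 k).sub (s2 k)).sub (s4 k)
    have s6 : Sm (fun y => ∑ k, ((pd (U k) j y * φ k y - U k y * pd (φ k) j y)
      - U j y * U k y * φ k y)) := ContDiff.sum fun k _ => s5 k
    have e1 := pd_sub s6 (hq.mul (sφ j)) j
    change pd (fun y => (∑ k, ((pd (U k) j y * φ k y - U k y * pd (φ k) j y)
      - U j y * U k y * φ k y)) - q y * φ j y) j y = _
    rw [e1, pd_sum _ s5, pd_mul hq (sφ j)]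
    beta_reduce
    congr 1
    refine Finset.sum_congr rfl fun k _ => ?_
    rw [pd_sub ((s1 k).sub (s2 k)) (s4 k), pd_sub (s1 k) (s2 k), pd_mul ((hU k).pd j) (sφ k),
      pd_mul (hU k) ((sφ k).pd j), pd_mul (s3 k) (sφ k), pd_mul (hU j) (hU k)]
    ring
  have sG : ∀ j, Sm (G j) := fun j =>
    (ContDiff.sum fun k (_ : k ∈ Finset.univ) =>
      ((((hU k).pd j).mul (sφ k)).sub ((hU k).mul ((sφ k).pd j))).sub
        (((hU j).mul (hU k)).mul (sφ k))).sub (hq.mul (sφ j))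
  have hG0 : ∫ y, ∑ j, pd (G j) j y = 0 := by
    refine integral_sum_pd_eq_zero (x := x) (ρ := ρ) (fun j => ?_) (fun j y hy => ?_)
    · exact sG j
    · simp [G, pφ _ y hy, (pφ _).pd j y hy]
  have e0 := integral_div_free hU hdiv (hg.pd i).lap (h.pd i).lap
  have key : ∀ y, ∑ k, a k y * φ k y =
      ((∑ k, U k y * pd (lap (pd g i)) k y) - U i y * lap (lap g) y)
      + (∑ k, ∑ j, U j y * U k y * pd (φ k) j y) + ∑ j, pd (G j) j y := by
    intro y
    have ha : ∀ k, a k y = lap (U k) y - (∑ j, U j y * pd (U k) j y) - pd q k y := fun k => by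
      linarith [hns y k]
    have hl : (∑ k, U k y * pd (lap (pd g i)) k y) - U i y * lap (lap g) y
        = ∑ k, U k y * lap (φ k) y := by
      simp only [hφ, lap_cc hg, mul_sub, Finset.sum_sub_distrib]
      simp
    have hd1 := hdiv y
    have hd2 := div_cc hg i y
    rw [hl]
    simp only [hG, ha]
    simp only [lap, ← hφ, Fin.sum_univ_three] at hd1 hd2 ⊢
    have e2 : pd (φ 2) 2 y = - pd (φ 0) 0 y - pd (φ 1) 1 y := by linarith
    have e3 : pd (U 2) 2 y = - pd (U 0) 0 y - pd (U 1) 1 y := by linarith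
    rw [e2, e3]
    ring
  simp only [key]
  have i1 : Integrable (fun y => ∑ k, U k y * pd (lap (pd g i)) k y) :=
    integrable_finsetSum _ fun k _ => (((h.pd i).lap.pd k).mul_left _).integrable
      ((hU k).continuous.mul ((hg.pd i).lap.pd k).continuous)
  have i2 : Integrable (fun y => U i y * lap (lap g) y) :=
    (h.lap.lap.mul_left _).integrable ((hU i).continuous.mul hg.lap.lap.continuous)
  have i3 : Integrable (fun y => ∑ k, ∑ j, U j y * U k y * pd (φ k) j y) :=
    integrable_finsetSum _ fun k _ => integrable_finsetSum _ fun j _ =>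
      (((pφ k).pd j).mul_left _).integrable
        (((hU j).continuous.mul (hU k).continuous).mul ((sφ k).pd j).continuous)
  have i4 : Integrable (fun y => ∑ j, pd (G j) j y) := by
    refine integrable_finsetSum _ fun j _ => ?_
    have pG : Supp x ρ (G j) := fun y hy => by simp [G, pφ _ y hy, (pφ _).pd j y hy]
    exact (pG.pd j).integrable ((sG j).pd j).continuous
  have i12 : Integrable (fun y => (∑ k, U k y * pd (lap (pd g i)) k y) - U i y * lap (lap g) y) :=
    i1.sub i2
  have i123 : Integrable (fun y => (∑ k, U k y * pd (lap (pd g i)) k y) - U i y * lap (lap g) y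
      + ∑ k, ∑ j, U j y * U k y * pd (φ k) j y) := i12.add i3
  rw [integral_add i123 i4, integral_add i12 i3, integral_sub i1 i2, e0, hG0]
  ring

/-- Components of a velocity field. -/
def comp (u : ℝ → E3 → E3) (k : Fin 3) (s : ℝ) (y : E3) : ℝ := u s y k

lemma IsNSSol.smJ {u : ℝ → E3 → E3} {q : ℝ → E3 → ℝ} {I : Set ℝ} (h : IsNSSol u q I) (k : Fin 3) :
    SmJ (comp u k) :=
  ((EuclideanSpace.proj k : E3 →L[ℝ] ℝ).contDiff).comp h.1

/-- Time-integrated weak formulation against `curl curl` of a time-dependent test function. -/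
lemma weak_identity {u : ℝ → E3 → E3} {q : ℝ → E3 → ℝ} (hu : IsNSSol u q (Icc 0 1))
    {t₀ t : ℝ} (h0 : 0 ≤ t₀) (ht : t₀ ≤ t) (h1 : t ≤ 1) {x : E3} {ρ : ℝ} {H : ℝ → E3 → ℝ}
    (hH : SmJ H) (pH : ∀ b, Supp x ρ (H b)) {b b' : ℝ → ℝ} (hb : Continuous b)
    (hb' : Continuous b') (hbd : ∀ s ∈ Ioo t₀ t, HasDerivAt b (b' s) s) (i : Fin 3) :
    - (∫ y, comp u i t y * lap (H (b t)) y) + ∫ y, comp u i t₀ y * lap (H (b t₀)) y =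
      ∫ s in t₀..t, (- (∫ y, comp u i s y * (b' s * lap (dt H (b s)) y + lap (lap (H (b s))) y)) +
        ∫ y, ∑ k, ∑ j, comp u j s y * comp u k s y * pd (cc (H (b s)) i k) j y) := by
  have sU := fun k => hu.smJ k
  have pdH : ∀ b, Supp x ρ (dt H b) := fun b y hy => by
    have : (fun s => H s y) = fun _ => 0 := by ext s; exact pH s y hy
    simp [dt, this]
  have hdiv : ∀ s ∈ Icc (0:ℝ) 1, ∀ y, ∑ k, pd (comp u k s) k y = 0 := fun s hs y => hu.2.2.2 s hs y
  have sub : ∀ s ∈ Icc t₀ t, s ∈ Icc (0:ℝ) 1 := fun s hs => ⟨h0.trans hs.1, hs.2.trans h1⟩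
  let D : ℝ → E3 → ℝ := fun s y => ∑ k, (dt (comp u k) s y * cc (H (b s)) i k y +
    comp u k s y * (b' s * cc (dt H (b s)) i k y))
  have cb : Continuous (fun z : ℝ × E3 => (b z.1, z.2)) :=
    (hb.comp continuous_fst).prodMk continuous_snd
  have hDc : Continuous (fun z : ℝ × E3 => D z.1 z.2) := by
    refine continuous_finsetSum _ fun k _ => ?_
    have c1 : Continuous (fun z : ℝ × E3 => cc (H (b z.1)) i k z.2) :=
      (hH.cc i k).continuous.comp cb
    have c2 : Continuous (fun z : ℝ × E3 => cc (dt H (b z.1)) i k z.2) :=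
      (hH.dt.cc i k).continuous.comp cb
    exact ((sU k).dt.continuous.mul c1).add
      ((sU k).continuous.mul ((hb'.comp continuous_fst).mul c2))
  have hDs : ∀ s, Supp x ρ (D s) := fun s y hy => by
    simp [D, (pH _).cc i _ y hy, (pdH _).cc i _ y hy]
  have hDi : Integrable (Function.uncurry D) ((volume.restrict (Set.uIoc t₀ t)).prod volume) := by
    have e : (volume.restrict (Set.uIoc t₀ t)).prod (volume : Measure E3) =
        (volume : Measure (ℝ × E3)).restrict (Set.uIoc t₀ t ×ˢ univ) := by
      rw [← Measure.restrict_univ (μ := (volume : Measure E3)), Measure.prod_restrict]; rfl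
    rw [e]
    have i1 : IntegrableOn (Function.uncurry D) (Icc t₀ t ×ˢ closedBall x ρ) :=
      hDc.continuousOn.integrableOn_compact (isCompact_Icc.prod (isCompact_closedBall x ρ))
    refine (i1.of_forall_sdiff_eq_zero (measurableSet_uIoc.prod MeasurableSet.univ) ?_)
    rintro ⟨s, y⟩ ⟨⟨hs, -⟩, hn⟩
    rw [uIoc_of_le ht] at hs
    exact hDs s y fun hy => hn ⟨Ioc_subset_Icc_self hs, hy⟩
  have hFTC : ∀ y, ∫ s in t₀..t, D s y =
      (∑ k, comp u k t y * cc (H (b t)) i k y) - ∑ k, comp u k t₀ y * cc (H (b t₀)) i k y := by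
    intro y
    refine intervalIntegral.integral_eq_sub_of_hasDerivAt_of_le ht
      (f := fun s => ∑ k, comp u k s y * cc (H (b s)) i k y) ?_ (fun s hs => ?_) ?_
    · refine Continuous.continuousOn (continuous_finsetSum _ fun k _ => ?_)
      have c1 : Continuous (fun s => comp u k s y) :=
        (sU k).continuous.comp (continuous_id.prodMk continuous_const)
      have c2 : Continuous (fun s => cc (H (b s)) i k y) :=
        (hH.cc i k).continuous.comp (hb.prodMk continuous_const)
      exact c1.mul c2
    · refine HasDerivAt.fun_sum fun k _ => ?_
      have d2 : HasDerivAt (fun s => cc (H (b s)) i k y) (cc (dt H (b s)) i k y * b' s) s :=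
        (hasDerivAt_cc hH i k (b s) y).comp s (hbd s hs)
      rw [mul_comm] at d2
      exact ((sU k).hasDerivAt s y).mul d2
    · exact (hDc.comp (continuous_id.prodMk continuous_const)).intervalIntegrable _ _
  have hW : ∀ s ∈ Icc t₀ t, ∫ y, ∑ k, comp u k s y * cc (H (b s)) i k y
      = - ∫ y, comp u i s y * lap (H (b s)) y := fun s hs =>
    integral_mul_cc (fun k => (sU k).sm s) (hdiv s (sub s hs)) (hH.sm _) (pH _) i
  have iW : ∀ s, Integrable (fun y => ∑ k, comp u k s y * cc (H (b s)) i k y) := fun s =>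
    integrable_finsetSum _ fun k _ => (((pH _).cc i k).mul_left _).integrable
      (((sU k).sm s).continuous.mul ((hH.sm _).cc i k).continuous)
  have hswap := intervalIntegral_integral_swap hDi
  simp only [hFTC] at hswap
  rw [integral_sub (iW t) (iW t₀), hW t ⟨ht, le_rfl⟩, hW t₀ ⟨le_rfl, ht⟩] at hswap
  rw [← sub_neg_eq_add, ← hswap]
  refine intervalIntegral.integral_congr fun s hs => ?_
  rw [uIcc_of_le ht] at hs
  have hm := momentum (a := fun k => dt (comp u k) s) (q := q s) (fun k => (sU k).sm s)
    (SmJ.sm hu.2.1 s) (hdiv s (sub s hs)) (fun y k => hu.2.2.1 s (sub s hs) y k)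
    (hH.sm (b s)) (pH (b s)) i
  have hc := integral_mul_cc (fun k => (sU k).sm s) (hdiv s (sub s hs)) (hH.dt.sm (b s))
    (pdH (b s)) i
  have i1 : Integrable (fun y => ∑ k, dt (comp u k) s y * cc (H (b s)) i k y) :=
    integrable_finsetSum _ fun k _ => (((pH _).cc i k).mul_left _).integrable
      (((sU k).dt.sm s).continuous.mul ((hH.sm _).cc i k).continuous)
  have i2 : Integrable (fun y => ∑ k, comp u k s y * cc (dt H (b s)) i k y) :=
    integrable_finsetSum _ fun k _ => (((pdH _).cc i k).mul_left _).integrable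
      (((sU k).sm s).continuous.mul ((hH.dt.sm _).cc i k).continuous)
  have i3 : Integrable (fun y => comp u i s y * lap (dt H (b s)) y) :=
    ((pdH _).lap.mul_left _).integrable (((sU i).sm s).continuous.mul (hH.dt.sm _).lap.continuous)
  have i4 : Integrable (fun y => comp u i s y * lap (lap (H (b s))) y) :=
    ((pH _).lap.lap.mul_left _).integrable
      (((sU i).sm s).continuous.mul (hH.sm _).lap.lap.continuous)
  have eD : ∀ y, D s y = (∑ k, dt (comp u k) s y * cc (H (b s)) i k y) +
      b' s * ∑ k, comp u k s y * cc (dt H (b s)) i k y := fun y => by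
    simp only [D, Finset.sum_add_distrib, Finset.mul_sum]
    congr 1
    exact Finset.sum_congr rfl fun k _ => by ring
  have eR : ∀ y, comp u i s y * (b' s * lap (dt H (b s)) y + lap (lap (H (b s))) y) =
      b' s * (comp u i s y * lap (dt H (b s)) y) + comp u i s y * lap (lap (H (b s))) y :=
    fun y => by ring
  simp only [eD, eR]
  rw [integral_add i1 (i2.const_mul _), integral_const_mul, integral_add (i3.const_mul _) i4,
    integral_const_mul, hm, hc]
  ring

/-! ### The heat-type kernel -/

/-- The moments `∫₀¹ (-τ²)ⁿ exp(-wτ²) dτ`. -/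
def GG (n : ℕ) (w : ℝ) : ℝ := ∫ τ in (0:ℝ)..1, (-τ ^ 2) ^ n * exp (-(w * τ ^ 2))

lemma hasDerivAt_GG (n : ℕ) (w : ℝ) : HasDerivAt (GG n) (GG (n + 1) w) w := by
  refine (intervalIntegral.hasDerivAt_integral_of_dominated_loc_of_deriv_le (μ := volume)
    (F := fun w τ => (-τ ^ 2) ^ n * exp (-(w * τ ^ 2)))
    (F' := fun w τ => (-τ ^ 2) ^ (n + 1) * exp (-(w * τ ^ 2))) (bound := fun _ => exp (|w| + 1))
    (ball_mem_nhds w one_pos) ?_ ?_ ?_ ?_ ?_ ?_).2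
  · exact Eventually.of_forall fun z => Continuous.aestronglyMeasurable (by fun_prop)
  · exact Continuous.intervalIntegrable (by fun_prop) _ _
  · exact Continuous.aestronglyMeasurable (by fun_prop)
  · refine Eventually.of_forall fun τ hτ z hz => ?_
    rw [uIoc_of_le zero_le_one] at hτ
    have h1 : τ ^ 2 ≤ 1 := pow_le_one₀ hτ.1.le hτ.2
    have h2 : |(-τ ^ 2) ^ (n + 1)| ≤ 1 := by
      rw [abs_pow, abs_neg, abs_of_nonneg (sq_nonneg τ)]
      exact pow_le_one₀ (sq_nonneg _) h1
    rw [norm_eq_abs, abs_mul, abs_exp]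
    have hz' : |z - w| < 1 := hz
    have h3 : -(z * τ ^ 2) ≤ |w| + 1 := by
      have : |z| ≤ |w| + 1 := by
        have := abs_sub_abs_le_abs_sub z w; linarith
      calc -(z * τ ^ 2) ≤ |z| * τ ^ 2 := by nlinarith [neg_abs_le z, sq_nonneg τ]
        _ ≤ |z| * 1 := by gcongr
        _ ≤ _ := by linarith
    calc _ ≤ 1 * exp (|w| + 1) := by gcongr
      _ = _ := one_mul _
  · exact intervalIntegrable_const
  · refine Eventually.of_forall fun τ _ z _ => ?_
    have h : HasDerivAt (fun w => -(w * τ ^ 2)) (-(1 * τ ^ 2)) z :=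
      ((hasDerivAt_id z).mul_const _).neg
    refine (h.exp.const_mul ((-τ ^ 2) ^ n)).congr_deriv ?_
    ring

lemma contDiff_GG (n : ℕ) : ContDiff ℝ (⊤ : ℕ∞) (GG n) := by
  rw [contDiff_infty]
  intro m
  induction m generalizing n with
  | zero => exact contDiff_zero.2 (continuous_iff_continuousAt.2 fun w =>
      (hasDerivAt_GG n w).continuousAt)
  | succ m ih =>
    have : deriv (GG n) = GG (n + 1) := funext fun w => (hasDerivAt_GG n w).deriv
    push_cast
    rw [contDiff_succ_iff_deriv]
    exact ⟨fun w => (hasDerivAt_GG n w).differentiableAt, by simp, this ▸ ih (n + 1)⟩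

/-- The Gaussian `exp(-b²|y-x|²/4)`. -/
def EE (x : E3) (b : ℝ) (y : E3) : ℝ := exp (-(b ^ 2 * ‖y - x‖ ^ 2 / 4))

/-- The potential `∫₀ᵇ exp(-θ²|y-x|²/4) dθ` of the Gaussian. -/
def PP (x : E3) (b : ℝ) (y : E3) : ℝ := b * GG 0 (b ^ 2 * ‖y - x‖ ^ 2 / 4)

lemma smJ_arg (x : E3) : SmJ (fun b y => b ^ 2 * ‖y - x‖ ^ 2 / 4) := by
  have h : ContDiff ℝ (⊤ : ℕ∞) (fun q : ℝ × E3 => ‖q.2 - x‖ ^ 2) :=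
    (contDiff_snd.sub contDiff_const).norm_sq ℝ
  exact ((contDiff_fst.pow 2).mul h).div_const 4

lemma smJ_EE (x : E3) : SmJ (EE x) := (smJ_arg x).neg.exp

lemma smJ_PP (x : E3) : SmJ (PP x) := contDiff_fst.mul ((contDiff_GG 0).comp (smJ_arg x))

lemma PP_eq (x : E3) (b : ℝ) (y : E3) : PP x b y = ∫ θ in (0:ℝ)..b, EE x θ y := by
  have := intervalIntegral.mul_integral_comp_mul_left (a := 0) (b := 1)
    (f := fun θ => EE x θ y) (c := b)
  rw [mul_zero, mul_one] at this
  rw [← this, PP, GG]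
  congr 1
  refine intervalIntegral.integral_congr fun τ _ => ?_
  simp only [EE, pow_zero, one_mul]
  congr 1; ring

lemma dt_PP (x : E3) : dt (PP x) = EE x := by
  ext b y
  have h : (fun s => PP x s y) = fun s => ∫ θ in (0:ℝ)..s, EE x θ y := by
    ext s; exact PP_eq x s y
  have hc : Continuous (fun θ => EE x θ y) :=
    (smJ_EE x).continuous.comp (continuous_id.prodMk continuous_const)
  rw [dt, h]
  exact (intervalIntegral.integral_hasDerivAt_right (hc.intervalIntegrable _ _)
    (hc.stronglyMeasurableAtFilter _ _) hc.continuousAt).deriv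

lemma dL_zero (l : List (Fin 3)) : dL l (fun _ => 0) = fun _ => 0 := by
  induction l with
  | nil => rfl
  | cons i l ih => ext y; simp [dL, ih, pd]

lemma PP_zero (x : E3) : PP x 0 = fun _ => 0 := by ext y; simp [PP]

lemma pd_normsq (x : E3) (c : ℝ) (i : Fin 3) :
    pd (fun y => c * ‖y - x‖ ^ 2) i = fun y => 2 * c * (y i - x i) := by
  ext y
  have h : HasFDerivAt (fun y : E3 => ‖y - x‖ ^ 2) (2 • (innerSL ℝ (y - x))) y := by
    have := ((hasFDerivAt_id (𝕜 := ℝ) y).sub_const x).norm_sq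
    simpa using this
  rw [pd, (h.const_mul c).fderiv]
  simp [EuclideanSpace.inner_single_right]
  ring

lemma pd_coord (x : E3) (c : ℝ) (i j : Fin 3) :
    pd (fun y => c * (y i - x i)) j = fun _ => if i = j then c else 0 := by
  ext y
  have h : HasFDerivAt (fun y : E3 => y i) (EuclideanSpace.proj i : E3 →L[ℝ] ℝ) y :=
    (EuclideanSpace.proj i : E3 →L[ℝ] ℝ).hasFDerivAt
  rw [pd, ((h.sub_const (x i)).const_mul c).fderiv]
  by_cases hij : i = j <;> simp [hij]

lemma sm_coord (i : Fin 3) : Sm (fun y : E3 => y i) :=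
  (EuclideanSpace.proj i : E3 →L[ℝ] ℝ).contDiff

lemma sm_normsq (x : E3) (c : ℝ) : Sm (fun y => c * ‖y - x‖ ^ 2) :=
  contDiff_const.mul ((contDiff_id.sub contDiff_const).norm_sq ℝ)

lemma pd_exp {f : E3 → ℝ} (hf : Sm f) (i : Fin 3) :
    pd (fun y => exp (f y)) i = fun y => pd f i y * exp (f y) := by
  ext y
  rw [pd, ((hf.diff y).hasFDerivAt.exp).fderiv]
  simp [pd, mul_comm]

lemma EE_eq (x : E3) (b : ℝ) : EE x b = fun y => exp (-(b ^ 2 / 4) * ‖y - x‖ ^ 2) := by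
  ext y; simp only [EE]; congr 1; ring

lemma pd_EE (x : E3) (b : ℝ) (i : Fin 3) :
    pd (EE x b) i = fun y => (-(b ^ 2 / 2) * (y i - x i)) * EE x b y := by
  rw [EE_eq, pd_exp (sm_normsq x _), pd_normsq]
  ext y; ring_nf

lemma lap_EE (x : E3) (b : ℝ) (y : E3) :
    lap (EE x b) y = (-(3 * b ^ 2 / 2) + b ^ 4 / 4 * ‖y - x‖ ^ 2) * EE x b y := by
  have h : ∀ i, pd (pd (EE x b) i) i y =
      (-(b ^ 2 / 2) + b ^ 4 / 4 * (y i - x i) ^ 2) * EE x b y := by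
    intro i
    have s : Sm (fun y : E3 => -(b ^ 2 / 2) * (y i - x i)) :=
      contDiff_const.mul ((sm_coord i).sub contDiff_const)
    rw [pd_EE, pd_mul s ((smJ_EE x).sm b), pd_coord, pd_EE]
    simp; ring
  simp only [lap, h, EuclideanSpace.norm_sq_eq, Fin.sum_univ_three, norm_eq_abs, sq_abs]
  simp; ring

lemma lap_PP (x : E3) (b : ℝ) (y : E3) : lap (PP x b) y = -(b ^ 3 / 2) * EE x b y := by
  have h1 : ∀ s, HasDerivAt (fun s => lap (PP x s) y) (lap (EE x s) y) s := fun s => by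
    have := (smJ_PP x).lap.hasDerivAt s y
    rwa [dt_lap (smJ_PP x), dt_PP] at this
  have h2 : ∀ s, HasDerivAt (fun s => -(s ^ 3 / 2) * EE x s y) (lap (EE x s) y) s := fun s => by
    have e1 : HasDerivAt (fun s : ℝ => -(s ^ 3 / 2)) (-(3 * s ^ 2 / 2)) s := by
      have := ((hasDerivAt_pow 3 s).div_const 2).fun_neg
      simpa using this
    have e2 : HasDerivAt (fun s : ℝ => EE x s y) (EE x s y * (-(2 * s * ‖y - x‖ ^ 2 / 4))) s := by
      have := (((hasDerivAt_pow 2 s).mul_const (‖y - x‖ ^ 2)).div_const 4).fun_neg.exp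
      simpa [EE] using this
    refine (e1.mul e2).congr_deriv ?_
    rw [lap_EE]; ring
  have h3 : ∀ s, HasDerivAt (fun s => lap (PP x s) y - (-(s ^ 3 / 2) * EE x s y)) 0 s := fun s => by
    simpa using (h1 s).fun_sub (h2 s)
  have := is_const_of_deriv_eq_zero (fun s => (h3 s).differentiableAt) (fun s => (h3 s).deriv) b 0
  have h0 : lap (PP x 0) y = 0 := by
    rw [PP_zero]; simp [lap, pd]
  simp only [h0] at this
  simp at this
  linarith

/-! ### Derivative bounds for the kernel -/

lemma dL_mul_bound {n : ℕ} {f g : E3 → ℝ} (hf : Sm f) (hg : Sm g) {y : E3} {F G a : ℝ}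
    (h1 : ∀ l : List (Fin 3), l.length ≤ n → |dL l f y| ≤ F * a ^ l.length)
    (h2 : ∀ l : List (Fin 3), l.length ≤ n → |dL l g y| ≤ G * a ^ l.length) :
    ∀ l : List (Fin 3), l.length = n → |dL l (fun y => f y * g y) y| ≤ F * G * (2 * a) ^ n := by
  induction n generalizing f g F G with
  | zero =>
    intro l hl
    have hl' := List.length_eq_zero_iff.1 hl
    subst hl'
    have e1 := h1 [] (by simp)
    have e2 := h2 [] (by simp)
    simp only [dL, List.length_nil, pow_zero, mul_one] at e1 e2 ⊢
    rw [abs_mul]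
    exact mul_le_mul e1 e2 (abs_nonneg _) ((abs_nonneg _).trans e1)
  | succ n ih =>
    intro l hl
    rcases List.eq_nil_or_concat l with rfl | ⟨l, i, rfl⟩
    · simp at hl
    · simp only [List.concat_eq_append, List.length_append, List.length_singleton,
        Nat.add_right_cancel_iff] at hl
      have hsplit : ∀ {f : E3 → ℝ} {F : ℝ}, (∀ l : List (Fin 3), l.length ≤ n + 1 →
          |dL l f y| ≤ F * a ^ l.length) → ∀ l : List (Fin 3), l.length ≤ n →
          |dL l (pd f i) y| ≤ F * a * a ^ l.length := fun {f F} h l hl => by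
        have := h (l ++ [i]) (by simpa using hl)
        rw [dL_append, List.length_append, List.length_singleton, pow_succ] at this
        simpa [dL, mul_assoc, mul_comm, mul_left_comm] using this
      rw [List.concat_eq_append, dL_append]
      simp only [dL]
      rw [pd_mul hf hg, dL_add ((hf.pd i).mul hg) (hf.mul (hg.pd i))]
      have a1 := ih (hf.pd i) hg (hsplit h1) (fun l hl => h2 l (by omega)) l hl
      have a2 := ih hf (hg.pd i) (fun l hl => h1 l (by omega)) (hsplit h2) l hl
      calc _ ≤ _ := abs_add_le _ _
        _ ≤ _ := add_le_add a1 a2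
        _ = _ := by ring

lemma dL_exp_bound {f : E3 → ℝ} (hf : Sm f) {y : E3} {a : ℝ}
    (h : ∀ l : List (Fin 3), l ≠ [] → |dL l f y| ≤ a ^ l.length) (ha : 0 ≤ a) (n : ℕ) :
    ∀ l : List (Fin 3), l.length ≤ n →
      |dL l (fun y => exp (f y)) y| ≤ 2 ^ (n * n) * exp (f y) * a ^ l.length := by
  induction n with
  | zero =>
    intro l hl
    have hl' := List.length_eq_zero_iff.1 (Nat.le_zero.1 hl)
    subst hl'
    simp [dL, abs_exp]
  | succ n ih =>
    intro l hl
    have mono : (2:ℝ) ^ (n * n) ≤ 2 ^ ((n + 1) * (n + 1)) :=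
      pow_le_pow_right₀ one_le_two (by nlinarith)
    rcases Nat.lt_or_ge n l.length with h1 | h1
    · rcases List.eq_nil_or_concat l with rfl | ⟨l, i, rfl⟩
      · simp at h1
      · simp only [List.concat_eq_append, List.length_append, List.length_singleton] at hl h1 ⊢
        have hln : l.length = n := by omega
        rw [dL_append]
        simp only [dL]
        rw [pd_exp hf]
        have := dL_mul_bound (n := n) (F := a) (a := a) (hf.pd i) hf.exp (fun m _ => by
          have := h (m ++ [i]) (by simp)
          rw [dL_append, List.length_append, List.length_singleton, pow_succ, mul_comm] at this
          simpa [dL] using this) ih l hln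
        refine this.trans ?_
        rw [hln, mul_pow]
        calc a * (2 ^ (n * n) * exp (f y)) * (2 ^ n * a ^ n)
            = 2 ^ (n * n + n) * exp (f y) * a ^ (n + 1) := by ring
          _ ≤ _ := by
            gcongr
            · exact one_le_two
            · nlinarith
    · refine (ih l h1).trans ?_
      gcongr

lemma dL_quadratic (x : E3) (c : ℝ) (l : List (Fin 3)) (hl : 2 ≤ l.length) :
    ∃ d : ℝ, |d| ≤ 2 * |c| ∧ (2 < l.length → d = 0) ∧
      dL l (fun y => c * ‖y - x‖ ^ 2) = fun _ => d := by
  induction l with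
  | nil => simp at hl
  | cons j l ih =>
    rcases l with _ | ⟨i, l⟩
    · simp at hl
    rcases l with _ | ⟨k, l⟩
    · simp only [dL]
      refine ⟨if i = j then 2 * c else 0, ?_, by simp, ?_⟩
      · split_ifs
        · rw [abs_mul, abs_two]
        · simp
      · rw [pd_normsq, pd_coord]
    · obtain ⟨d, -, -, h⟩ := ih (by simp)
      refine ⟨0, by simp, fun _ => rfl, ?_⟩
      rw [dL, h]
      ext y; simp [pd]

lemma abs_coord_le (z : E3) (i : Fin 3) : |z i| ≤ ‖z‖ := by
  have := EuclideanSpace.norm_sq_eq z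
  have h2 : ‖z i‖ ^ 2 ≤ ∑ j, ‖z j‖ ^ 2 :=
    Finset.single_le_sum (f := fun j => ‖z j‖ ^ 2) (fun j _ => sq_nonneg _) (Finset.mem_univ i)
  rw [← norm_eq_abs]
  exact le_of_sq_le_sq (by rw [this]; exact h2) (norm_nonneg _)

lemma dL_EE_bound_exp (x y : E3) {b : ℝ} (hb : 0 ≤ b) (l : List (Fin 3)) :
    |dL l (EE x b) y| ≤ 2 ^ (l.length * l.length) * EE x b y *
      (b * (1 + b * ‖y - x‖)) ^ l.length := by
  rw [EE_eq]
  have hz := norm_nonneg (y - x)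
  refine dL_exp_bound (sm_normsq x _) (fun l hl => ?_) (by positivity) _ l le_rfl
  have hb1 : b ≤ b * (1 + b * ‖y - x‖) := by
    nlinarith [mul_nonneg hb (mul_nonneg hb hz)]
  rcases l with _ | ⟨i, l⟩
  · exact absurd rfl hl
  rcases l with _ | ⟨j, l⟩
  · simp only [dL, List.length_singleton, pow_one]
    rw [pd_normsq, abs_mul]
    have h1 : |y i - x i| ≤ ‖y - x‖ := abs_coord_le (y - x) i
    have h2 : |2 * -(b ^ 2 / 4)| = b ^ 2 / 2 := by
      rw [show 2 * -(b ^ 2 / 4) = -(b ^ 2 / 2) by ring, abs_neg, abs_of_nonneg (by positivity)]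
    rw [h2]
    calc b ^ 2 / 2 * |y i - x i| ≤ b ^ 2 / 2 * ‖y - x‖ := by gcongr
      _ ≤ _ := by nlinarith [mul_nonneg (sq_nonneg b) hz]
  · obtain ⟨d, h1, h2, h3⟩ := dL_quadratic x (-(b ^ 2 / 4)) (i :: j :: l) (by simp)
    rw [h3]
    rcases l with _ | ⟨k, l⟩
    · simp only [List.length_cons, List.length_nil]
      refine h1.trans ?_
      rw [abs_neg, abs_of_nonneg (by positivity)]
      calc 2 * (b ^ 2 / 4) ≤ b ^ 2 := by nlinarith [sq_nonneg b]
        _ ≤ _ := by gcongr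
    · rw [h2 (by simp), abs_zero]; positivity

lemma pow_mul_exp_bound (m : ℕ) {w : ℝ} (hw : 0 ≤ w) :
    (1 + w) ^ m * exp (-(w ^ 2 / 4)) ≤ m.factorial * exp 2 := by
  have h1 : (1 + w) ^ m ≤ m.factorial * exp (1 + w) := by
    have := pow_div_factorial_le_exp (1 + w) (by positivity) m
    rwa [div_le_iff₀ (by positivity), mul_comm] at this
  calc _ ≤ m.factorial * exp (1 + w) * exp (-(w ^ 2 / 4)) := by gcongr
    _ = m.factorial * exp (1 + w + -(w ^ 2 / 4)) := by rw [mul_assoc, ← exp_add]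
    _ ≤ _ := by gcongr; nlinarith [sq_nonneg (w - 2)]

/-- The harmonic mean scale `b / (1 + b|y-x|)`. -/
def mm (x : E3) (b : ℝ) (y : E3) : ℝ := b / (1 + b * ‖y - x‖)

lemma dL_EE_bound (n : ℕ) : ∃ C : ℝ, ∀ (x y : E3) (b : ℝ), 0 ≤ b → ∀ l : List (Fin 3),
    l.length = n → |dL l (EE x b) y| ≤ C * (b ^ n / (1 + b * ‖y - x‖) ^ (n + 3)) := by
  refine ⟨2 ^ (n * n) * ((2 * n + 3).factorial * exp 2), fun x y b hb l hl => ?_⟩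
  refine (dL_EE_bound_exp x y hb l).trans ?_
  rw [hl]
  have hz := norm_nonneg (y - x)
  have hp := pow_mul_exp_bound (2 * n + 3) (mul_nonneg hb hz)
  have hE : EE x b y = exp (-((b * ‖y - x‖) ^ 2 / 4)) := by rw [EE, mul_pow]
  rw [← hE] at hp
  have h1 : 0 < 1 + b * ‖y - x‖ := by positivity
  have e : (2:ℝ) ^ (n * n) * EE x b y * (b * (1 + b * ‖y - x‖)) ^ n = 2 ^ (n * n) *
      ((1 + b * ‖y - x‖) ^ (2 * n + 3) * EE x b y) * (b ^ n / (1 + b * ‖y - x‖) ^ (n + 3)) := by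
    rw [mul_pow, show 2 * n + 3 = n + (n + 3) by ring, pow_add]
    field_simp
  rw [e]
  gcongr

lemma mm_nonneg (x : E3) {b : ℝ} (hb : 0 ≤ b) (y : E3) : 0 ≤ mm x b y := by
  unfold mm; positivity

lemma dL_PP_bound (n : ℕ) : ∃ C : ℝ, ∀ (x y : E3) (b : ℝ), 0 ≤ b → ∀ l : List (Fin 3),
    l.length = n → |dL l (PP x b) y| ≤ C * mm x b y ^ (n + 1) := by
  obtain ⟨C, hC⟩ := dL_EE_bound n
  have hC0 : 0 ≤ C := by
    have := (abs_nonneg _).trans (hC 0 0 1 zero_le_one (List.replicate n 0) (by simp))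
    simpa using this
  refine ⟨C, fun x y b hb l hl => ?_⟩
  have hz := norm_nonneg (y - x)
  have hd : ∀ s, HasDerivAt (fun s => dL l (PP x s) y) (dL l (EE x s) y) s := fun s => by
    have := ((smJ_PP x).dL l).hasDerivAt s y
    rwa [dt_dL (smJ_PP x), dt_PP] at this
  have hB : ∀ s ∈ Icc 0 b, HasDerivAt (fun s => C * mm x s y ^ (n + 1))
      (C * ((n + 1) * (s / (1 + s * ‖y - x‖)) ^ n * (1 / (1 + s * ‖y - x‖) ^ 2))) s :=
      fun s hs => by
    have h0 := hs.1
    have h1 : 1 + s * ‖y - x‖ ≠ 0 := by positivity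
    have d1 : HasDerivAt (fun s : ℝ => 1 + s * ‖y - x‖) (1 * ‖y - x‖) s :=
      ((hasDerivAt_id s).mul_const _).const_add 1
    have := (((hasDerivAt_id s).fun_div d1 h1).fun_pow (n + 1)).const_mul C
    refine this.congr_deriv ?_
    push_cast
    simp only [id]
    congr 2
    field_simp
    ring
  have := image_norm_le_of_norm_deriv_right_le_deriv_boundary' (a := 0) (b := b)
    (f := fun s => dL l (PP x s) y) (f' := fun s => dL l (EE x s) y)
    (fun s _ => (hd s).continuousAt.continuousWithinAt) (fun s _ => (hd s).hasDerivWithinAt)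
    (B := fun s => C * mm x s y ^ (n + 1))
    (by simp [PP_zero, dL_zero, mm])
    (fun s hs => (hB s hs).continuousAt.continuousWithinAt)
    (fun s hs => (hB s ⟨hs.1, hs.2.le⟩).hasDerivWithinAt) (fun s hs => by
      have h0 := hs.1
      refine (hC x y s h0 l hl).trans ?_
      have h1 : 1 ≤ 1 + s * ‖y - x‖ := by nlinarith
      gcongr
      rw [div_pow, mul_assoc, div_mul_div_comm, mul_one, ← pow_add]
      calc s ^ n / (1 + s * ‖y - x‖) ^ (n + 3) ≤ s ^ n / (1 + s * ‖y - x‖) ^ (n + 2) := by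
            gcongr
            norm_num
        _ ≤ (n + 1) * (s ^ n / (1 + s * ‖y - x‖) ^ (n + 2)) := by
            refine le_mul_of_one_le_left (by positivity) ?_
            have : (0:ℝ) ≤ n := n.cast_nonneg
            linarith)
  simpa using this ⟨hb, le_rfl⟩

/-! ### The localized kernel -/

lemma exists_unif {P : ℕ → ℝ → Prop} (mono : ∀ k C C', C ≤ C' → P k C → P k C')
    (h : ∀ k, ∃ C, P k C) (n : ℕ) : ∃ C, 0 ≤ C ∧ ∀ k ≤ n, P k C := by
  induction n with
  | zero =>
    obtain ⟨C, hC⟩ := h 0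
    refine ⟨max C 0, le_max_right _ _, fun k hk => ?_⟩
    rw [Nat.le_zero.1 hk]; exact mono _ _ _ (le_max_left _ _) hC
  | succ n ih =>
    obtain ⟨C, h0, hC⟩ := ih
    obtain ⟨C', hC'⟩ := h (n + 1)
    refine ⟨max C C', h0.trans (le_max_left _ _), fun k hk => ?_⟩
    rcases Nat.lt_or_ge n k with h1 | h1
    · rw [show k = n + 1 by omega]; exact mono _ _ _ (le_max_right _ _) hC'
    · exact mono _ _ _ (le_max_left _ _) (hC k h1)

/-- The standard bump function. -/
def bump : ContDiffBump (0 : E3) := ⟨1 / 2, 1, by norm_num, by norm_num⟩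

/-- A cutoff equal to one on `B(x, ρ/2)` and supported in `B(x, ρ)`. -/
def eta (x : E3) (ρ : ℝ) (y : E3) : ℝ := bump (ρ⁻¹ • (y - x))

lemma sm_bump : Sm (fun z => bump z) := bump.contDiff

lemma contDiff_smul_sub (x : E3) (c : ℝ) :
    ContDiff ℝ (⊤ : ℕ∞) (fun y : E3 => c • (y - x)) := by fun_prop

lemma sm_eta (x : E3) (ρ : ℝ) : Sm (eta x ρ) :=
  sm_bump.comp (contDiff_smul_sub x _)

lemma dL_comp_smul {f : E3 → ℝ} (hf : Sm f) (x : E3) (c : ℝ) (l : List (Fin 3)) :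
    dL l (fun y => f (c • (y - x))) = fun y => c ^ l.length * dL l f (c • (y - x)) := by
  induction l with
  | nil => ext; simp [dL]
  | cons i l ih =>
    have h1 : ∀ {g : E3 → ℝ}, Sm g → pd (fun y => g (c • (y - x))) i =
        fun y => c * pd g i (c • (y - x)) := fun {g} hg => by
      ext y
      have e : HasFDerivAt (fun y : E3 => c • (y - x)) (c • ContinuousLinearMap.id ℝ E3) y :=
        ((hasFDerivAt_id (𝕜 := ℝ) y).sub_const x).const_smul c
      have := ((hg.diff (c • (y - x))).hasFDerivAt.comp y e).fderiv
      rw [pd]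
      change fderiv ℝ (g ∘ fun y => c • (y - x)) y _ = _
      rw [this]; simp [pd]
    have s : Sm (fun y => dL l f (c • (y - x))) :=
      (hf.dL l).comp (contDiff_smul_sub x _)
    simp only [dL, List.length_cons]
    rw [ih, pd_const_mul s, h1 (hf.dL l)]
    ext y; ring

lemma dL_eta_bound (n : ℕ) : ∃ C : ℝ, ∀ (x y : E3) (ρ : ℝ), 0 < ρ → ∀ l : List (Fin 3),
    l.length = n → |dL l (eta x ρ) y| ≤ C * ρ⁻¹ ^ n := by
  have hc : Continuous (iteratedFDeriv ℝ n (fun z => bump z)) :=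
    sm_bump.continuous_iteratedFDeriv (by exact_mod_cast le_top)
  obtain ⟨C, hC⟩ := hc.bounded_above_of_compact_support
    (bump.hasCompactSupport.iteratedFDeriv n)
  refine ⟨C, fun x y ρ hρ l hl => ?_⟩
  unfold eta
  rw [dL_comp_smul sm_bump, abs_mul, hl, abs_of_nonneg (by positivity), mul_comm]
  gcongr
  refine (abs_dL_le sm_bump l _).trans ?_
  rw [hl]; exact hC _

lemma eta_eq_one {x y : E3} {ρ : ℝ} (hρ : 0 < ρ) (h : y ∈ closedBall x (ρ / 2)) :
    eta x ρ y = 1 := by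
  refine bump.one_of_mem_closedBall ?_
  rw [mem_closedBall_zero_iff, norm_smul, norm_inv, norm_eq_abs, abs_of_pos hρ]
  rw [mem_closedBall, dist_eq_norm] at h
  change _ ≤ (1 / 2 : ℝ)
  rw [inv_mul_le_iff₀ hρ]; linarith

lemma supp_eta (x : E3) {ρ : ℝ} (hρ : 0 < ρ) : Supp x ρ (eta x ρ) := fun y hy => by
  refine bump.zero_of_le_dist ?_
  rw [dist_zero_right, norm_smul, norm_inv, norm_eq_abs, abs_of_pos hρ]
  rw [mem_closedBall, dist_eq_norm, not_le] at hy
  change (1 : ℝ) ≤ _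
  rw [le_inv_mul_iff₀ hρ]; linarith

/-- The localized potential. -/
def etaP (x : E3) (ρ b : ℝ) (y : E3) : ℝ := eta x ρ y * PP x b y

/-- The localized Gaussian. -/
def etaE (x : E3) (ρ b : ℝ) (y : E3) : ℝ := eta x ρ y * EE x b y

/-- The commutator of the cutoff with the Laplacian. -/
def qq (x : E3) (ρ b : ℝ) (y : E3) : ℝ := b ^ 3 / 2 * etaE x ρ b y + lap (etaP x ρ b) y

lemma smJ_etaP (x : E3) (ρ : ℝ) : SmJ (etaP x ρ) := ((sm_eta x ρ).comp contDiff_snd).mul (smJ_PP x)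

lemma smJ_etaE (x : E3) (ρ : ℝ) : SmJ (etaE x ρ) := ((sm_eta x ρ).comp contDiff_snd).mul (smJ_EE x)

lemma smJ_qq (x : E3) (ρ : ℝ) : SmJ (qq x ρ) :=
  (((contDiff_fst.pow 3).div_const 2).mul (smJ_etaE x ρ)).add (smJ_etaP x ρ).lap

lemma supp_etaP (x : E3) {ρ : ℝ} (hρ : 0 < ρ) (b : ℝ) : Supp x ρ (etaP x ρ b) := fun y hy => by
  simp [etaP, supp_eta x hρ y hy]

lemma supp_etaE (x : E3) {ρ : ℝ} (hρ : 0 < ρ) (b : ℝ) : Supp x ρ (etaE x ρ b) := fun y hy => by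
  simp [etaE, supp_eta x hρ y hy]

lemma supp_qq (x : E3) {ρ : ℝ} (hρ : 0 < ρ) (b : ℝ) : Supp x ρ (qq x ρ b) := fun y hy => by
  simp [qq, supp_etaE x hρ b y hy, (supp_etaP x hρ b).lap y hy]

lemma dt_etaP (x : E3) (ρ : ℝ) : dt (etaP x ρ) = etaE x ρ := by
  ext b y
  have h := ((smJ_PP x).hasDerivAt b y).const_mul (eta x ρ y)
  rw [dt_PP] at h
  exact h.deriv

lemma inv_le_mm {x y : E3} {ρ b : ℝ} (hρ : 0 < ρ) (hb : 0 < b) (h : 1 ≤ 2 * b * ρ)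
    (hy : y ∈ closedBall x ρ) : ρ⁻¹ ≤ 3 * mm x b y := by
  rw [mem_closedBall, dist_eq_norm] at hy
  have hz := norm_nonneg (y - x)
  unfold mm
  rw [inv_le_iff_one_le_mul₀ hρ, ← mul_div_assoc, div_mul_eq_mul_div,
    le_div_iff₀ (by positivity)]
  nlinarith

lemma mm_le (x y : E3) {b : ℝ} (hb : 0 ≤ b) : mm x b y ≤ b :=
  div_le_self hb (by nlinarith [norm_nonneg (y - x), mul_nonneg hb (norm_nonneg (y - x))])

lemma mm_mul_le (x y : E3) {b : ℝ} (hb : 0 ≤ b) : mm x b y * ‖y - x‖ ≤ 1 := by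
  have := mul_nonneg hb (norm_nonneg (y - x))
  rw [mm, div_mul_eq_mul_div, div_le_one (by positivity)]
  linarith

lemma dL_eta_mul_bound {K : ℝ → E3 → E3 → ℝ} (hK : ∀ b x, Sm (K b x)) (d : ℕ)
    (h : ∀ n, ∃ C : ℝ, ∀ (x y : E3) (b : ℝ), 0 ≤ b → ∀ l : List (Fin 3), l.length = n →
      |dL l (K b x) y| ≤ C * mm x b y ^ (n + d)) (n : ℕ) :
    ∃ C : ℝ, 0 ≤ C ∧ ∀ (x y : E3) (ρ b : ℝ), 0 < ρ → 0 < b → 1 ≤ 2 * b * ρ →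
      ∀ l : List (Fin 3), l.length = n →
      |dL l (fun y => eta x ρ y * K b x y) y| ≤ C * mm x b y ^ (n + d) := by
  obtain ⟨C1, h1, hC1⟩ := exists_unif (P := fun n C => ∀ (x y : E3) (b : ℝ), 0 ≤ b →
    ∀ l : List (Fin 3), l.length = n → |dL l (K b x) y| ≤ C * mm x b y ^ (n + d))
    (fun k C C' hCC h x y b hb l hl => (h x y b hb l hl).trans (by
      have := mm_nonneg x hb y
      gcongr)) h n
  obtain ⟨C2, h2, hC2⟩ := exists_unif (P := fun n C => ∀ (x y : E3) (ρ : ℝ), 0 < ρ →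
    ∀ l : List (Fin 3), l.length = n → |dL l (eta x ρ) y| ≤ C * ρ⁻¹ ^ n)
    (fun k C C' hCC h x y ρ hρ l hl => (h x y ρ hρ l hl).trans (by gcongr)) dL_eta_bound n
  refine ⟨C2 * C1 * 6 ^ n, by positivity, fun x y ρ b hρ hb hbρ l hl => ?_⟩
  have hm := mm_nonneg x hb.le y
  by_cases hy : y ∈ closedBall x ρ
  · have := dL_mul_bound (n := n) (y := y) (F := C2) (G := C1 * mm x b y ^ d) (a := 3 * mm x b y)
      (sm_eta x ρ) (hK b x)
      (fun l hl => (hC2 _ hl x y ρ hρ l rfl).trans (by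
        have := inv_le_mm hρ hb hbρ hy
        gcongr))
      (fun l hl => (hC1 _ hl x y b hb.le l rfl).trans (by
        rw [pow_add, mul_pow, mul_comm (mm x b y ^ l.length), ← mul_assoc]
        refine mul_le_mul_of_nonneg_left ?_ (by positivity)
        refine le_mul_of_one_le_left (by positivity) (one_le_pow₀ (by norm_num))))
      l hl
    refine this.trans (le_of_eq ?_)
    rw [pow_add, ← mul_assoc 2 3, mul_pow]
    ring
  · have : Supp x ρ (fun y => eta x ρ y * K b x y) := fun y hy => by simp [supp_eta x hρ y hy]
    rw [this.dL l y hy, abs_zero]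
    positivity

lemma dL_etaP_bound (n : ℕ) : ∃ C : ℝ, 0 ≤ C ∧ ∀ (x y : E3) (ρ b : ℝ), 0 < ρ → 0 < b →
    1 ≤ 2 * b * ρ → ∀ l : List (Fin 3), l.length = n →
      |dL l (etaP x ρ b) y| ≤ C * mm x b y ^ (n + 1) :=
  dL_eta_mul_bound (K := fun b x => PP x b) (fun b x => (smJ_PP x).sm b) 1 dL_PP_bound n

lemma dL_etaE_bound (n : ℕ) : ∃ C : ℝ, 0 ≤ C ∧ ∀ (x y : E3) (ρ b : ℝ), 0 < ρ → 0 < b →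
    1 ≤ 2 * b * ρ → ∀ l : List (Fin 3), l.length = n →
      |dL l (fun y => b ^ 3 / 2 * etaE x ρ b y) y| ≤ C * mm x b y ^ (n + 3) := by
  obtain ⟨C, hC0, hC⟩ := dL_eta_mul_bound (K := fun b x y => b ^ 3 / 2 * EE x b y)
    (fun b x => contDiff_const.mul ((smJ_EE x).sm b)) 3 (fun n => by
      obtain ⟨C, hC⟩ := dL_EE_bound n
      refine ⟨C / 2, fun x y b hb l hl => ?_⟩
      rw [dL_const_mul ((smJ_EE x).sm b), abs_mul, abs_of_nonneg (by positivity)]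
      calc _ ≤ _ := mul_le_mul_of_nonneg_left (hC x y b hb l hl) (by positivity)
        _ = _ := by rw [mm, div_pow, pow_add b]; ring) n
  refine ⟨C, hC0, fun x y ρ b hρ hb hbρ l hl => ?_⟩
  have := hC x y ρ b hρ hb hbρ l hl
  rwa [show (fun y => eta x ρ y * (b ^ 3 / 2 * EE x b y)) = fun y => b ^ 3 / 2 * etaE x ρ b y by
    ext y; simp only [etaE]; ring] at this

lemma abs_dL_lap_le {f : E3 → ℝ} {l : List (Fin 3)} {y : E3} {B : ℝ}
    (h : ∀ m : List (Fin 3), m.length = l.length + 2 → |dL m f y| ≤ B) (hf : Sm f) :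
    |dL l (lap f) y| ≤ 3 * B := by
  rw [← dL_lap hf]
  calc |∑ i, pd (pd (dL l f) i) i y| ≤ ∑ i : Fin 3, |pd (pd (dL l f) i) i y| :=
        Finset.abs_sum_le_sum_abs _ _
    _ ≤ ∑ _i : Fin 3, B := Finset.sum_le_sum fun i _ => h (i :: i :: l) (by simp)
    _ = 3 * B := by simp

lemma dL_lap_etaP_bound (n : ℕ) : ∃ C : ℝ, 0 ≤ C ∧ ∀ (x y : E3) (ρ b : ℝ), 0 < ρ → 0 < b →
    1 ≤ 2 * b * ρ → ∀ l : List (Fin 3), l.length = n →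
      |dL l (lap (etaP x ρ b)) y| ≤ C * mm x b y ^ (n + 3) := by
  obtain ⟨C, hC0, hC⟩ := dL_etaP_bound (n + 2)
  refine ⟨3 * C, by positivity, fun x y ρ b hρ hb hbρ l hl => ?_⟩
  rw [mul_assoc]
  exact abs_dL_lap_le (fun m hm => hC x y ρ b hρ hb hbρ m (by omega)) ((smJ_etaP x ρ).sm b)

lemma dL_congr_of_eventuallyEq {f g : E3 → ℝ} {y : E3} (h : f =ᶠ[𝓝 y] g) (l : List (Fin 3)) :
    dL l f =ᶠ[𝓝 y] dL l g := by
  induction l with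
  | nil => exact h
  | cons i l ih =>
    filter_upwards [ih.eventuallyEq_nhds] with z hz
    simp [dL, pd, hz.fderiv_eq]

lemma lap_congr_of_eventuallyEq {f g : E3 → ℝ} {y : E3} (h : f =ᶠ[𝓝 y] g) :
    lap f =ᶠ[𝓝 y] lap g := by
  have := fun i : Fin 3 => dL_congr_of_eventuallyEq h [i, i]
  filter_upwards [this 0, this 1, this 2] with z h0 h1 h2
  simp only [dL] at h0 h1 h2
  simp [lap, Fin.sum_univ_three, h0, h1, h2]

lemma qq_eventually_zero {x y : E3} {ρ : ℝ} (hρ : 0 < ρ) (b : ℝ) (hy : ‖y - x‖ < ρ / 2) :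
    qq x ρ b =ᶠ[𝓝 y] fun _ => 0 := by
  have hU : closedBall x (ρ / 2) ∈ 𝓝 y :=
    mem_of_superset (isOpen_ball.mem_nhds (by rwa [mem_ball, dist_eq_norm])) ball_subset_closedBall
  have h1 : etaP x ρ b =ᶠ[𝓝 y] PP x b := by
    filter_upwards [hU] with z hz
    simp [etaP, eta_eq_one hρ hz]
  filter_upwards [lap_congr_of_eventuallyEq h1, hU] with z hz hz'
  rw [qq, hz, lap_PP, etaE, eta_eq_one hρ hz']
  ring

lemma dL_qq_bound (n : ℕ) : ∃ C : ℝ, 0 ≤ C ∧ ∀ (x y : E3) (ρ b : ℝ), 0 < ρ → 0 < b →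
    1 ≤ 2 * b * ρ → ∀ l : List (Fin 3), l.length = n →
      |dL l (qq x ρ b) y| ≤ C * ρ⁻¹ ^ (n + 3) := by
  obtain ⟨C1, h1, hC1⟩ := dL_etaE_bound n
  obtain ⟨C2, h2, hC2⟩ := dL_lap_etaP_bound n
  refine ⟨(C1 + C2) * 2 ^ (n + 3), by positivity, fun x y ρ b hρ hb hbρ l hl => ?_⟩
  rcases lt_or_ge ‖y - x‖ (ρ / 2) with hy | hy
  · rw [(dL_congr_of_eventuallyEq (qq_eventually_zero hρ b hy) l).eq_of_nhds, dL_zero, abs_zero]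
    positivity
  · have hm := mm_nonneg x hb.le y
    have hm2 : mm x b y ≤ 2 * ρ⁻¹ := by
      have := mm_mul_le x y hb.le
      rw [← div_eq_mul_inv, le_div_iff₀ hρ]
      nlinarith
    have e : dL l (qq x ρ b) y = dL l (fun y => b ^ 3 / 2 * etaE x ρ b y) y +
        dL l (lap (etaP x ρ b)) y := by
      unfold qq
      rw [dL_add (contDiff_const.mul ((smJ_etaE x ρ).sm b)) ((smJ_etaP x ρ).sm b).lap]
    rw [e]
    calc _ ≤ _ := abs_add_le _ _
      _ ≤ C1 * mm x b y ^ (n + 3) + C2 * mm x b y ^ (n + 3) :=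
        add_le_add (hC1 x y ρ b hρ hb hbρ l hl) (hC2 x y ρ b hρ hb hbρ l hl)
      _ = (C1 + C2) * mm x b y ^ (n + 3) := by ring
      _ ≤ (C1 + C2) * (2 * ρ⁻¹) ^ (n + 3) := by gcongr
      _ = _ := by rw [mul_pow]; ring

/-! ### Pairings with the kernel -/

lemma abs_integral_mul_le {x : E3} {ρ : ℝ} {V K k : E3 → ℝ} (hs : Supp x ρ K)
    (h : ∀ y ∈ closedBall x ρ, |K y| ≤ k y)
    (hk : IntegrableOn (fun y => |V y| * k y) (closedBall x ρ)) :
    |∫ y, V y * K y| ≤ ∫ y in closedBall x ρ, |V y| * k y := by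
  rw [← setIntegral_eq_integral_of_forall_compl_eq_zero (s := closedBall x ρ)
    (fun y hy => by simp [hs y hy]), ← norm_eq_abs]
  refine norm_integral_le_of_norm_le hk ?_
  filter_upwards [ae_restrict_mem measurableSet_closedBall] with y hy
  rw [norm_mul, norm_eq_abs, norm_eq_abs]
  exact mul_le_mul_of_nonneg_left (h y hy) (abs_nonneg _)

lemma pairing {x : E3} {ρ : ℝ} {V K : E3 → ℝ} (hV : Sm V) (hK : Sm K) (hs : Supp x ρ K)
    (γ β : List (Fin 3)) {B : ℝ} (h : ∀ y, |dL γ K y| ≤ B) :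
    |∫ y, V y * dL (γ ++ β) K y| ≤ B * ∫ y in closedBall x ρ, |dL β V y| := by
  rw [dL_append, dL_comm hK, integral_mul_dL hV (hK.dL γ) (hs.dL γ), abs_mul, abs_pow, abs_neg,
    abs_one, one_pow, one_mul, mul_comm B, ← integral_mul_const]
  refine abs_integral_mul_le (hs.dL γ) (fun y _ => h y) ?_
  exact ((hV.dL β).continuous.abs.mul continuous_const).continuousOn.integrableOn_compact
    (isCompact_closedBall x ρ)

lemma cc_dL {g : E3 → ℝ} (h : Sm g) (l : List (Fin 3)) (i k : Fin 3) :
    cc (dL l g) i k = dL l (cc g i k) := by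
  have e : cc g i k = fun y => pd (pd g i) k y + (-(if k = i then 1 else 0)) * lap g y := by
    ext y; simp only [cc]; ring
  rw [e, dL_add ((h.pd i).pd k) (contDiff_const.mul h.lap), dL_const_mul h.lap, dL_pd (h.pd i),
    dL_pd h, ← dL_lap h]
  ext y; simp only [cc]; ring

lemma pd_cc_etaP_bound : ∃ C : ℝ, 0 ≤ C ∧ ∀ (x y : E3) (ρ b : ℝ), 0 < ρ → 0 < b →
    1 ≤ 2 * b * ρ → ∀ i k j, |pd (cc (etaP x ρ b) i k) j y| ≤ C * mm x b y ^ 4 := by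
  obtain ⟨C, hC0, hC⟩ := dL_etaP_bound 3
  refine ⟨4 * C, by positivity, fun x y ρ b hρ hb hbρ i k j => ?_⟩
  have hg := (smJ_etaP x ρ).sm b
  have h1 := hC x y ρ b hρ hb hbρ [j, k, i] rfl
  have h2 := abs_dL_lap_le (l := [j]) (y := y)
    (fun m hm => hC x y ρ b hρ hb hbρ m (by simpa using hm)) hg
  rw [pd_cc hg]
  simp only [dL] at h1 h2
  have h3 : |(if k = i then (1:ℝ) else 0) * pd (lap (etaP x ρ b)) j y| ≤
      |pd (lap (etaP x ρ b)) j y| := by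
    split_ifs <;> simp
  calc _ ≤ _ := abs_sub _ _
    _ ≤ C * mm x b y ^ (3 + 1) + 3 * (C * mm x b y ^ (3 + 1)) := add_le_add h1 (h3.trans h2)
    _ = _ := by ring

lemma continuous_mm (x : E3) {b : ℝ} (hb : 0 ≤ b) : Continuous (mm x b) := by
  unfold mm
  refine continuous_const.div (by fun_prop) fun y => ?_
  have := mul_nonneg hb (norm_nonneg (y - x))
  positivity

lemma nonlinear_pairing : ∃ C : ℝ, 0 ≤ C ∧ ∀ (x : E3) (ρ b : ℝ), 0 < ρ → 0 < b →
    1 ≤ 2 * b * ρ → ∀ (U : Fin 3 → E3 → ℝ), (∀ k, Sm (U k)) → ∀ (α : List (Fin 3)) (i : Fin 3)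
    (M : ℝ), (∀ j k, ∫ y in closedBall x ρ, |dL α (fun y => U j y * U k y) y| * mm x b y ^ 4 ≤ M) →
    |∫ y, ∑ k, ∑ j, U j y * U k y * pd (cc (dL α (etaP x ρ b)) i k) j y| ≤ C * M := by
  obtain ⟨C, hC0, hC⟩ := pd_cc_etaP_bound
  refine ⟨9 * C, by positivity, fun x ρ b hρ hb hbρ U hU α i M hM => ?_⟩
  have hg := (smJ_etaP x ρ).sm b
  have hs := supp_etaP x hρ b
  have e : ∀ k j, pd (cc (dL α (etaP x ρ b)) i k) j = dL α (pd (cc (etaP x ρ b) i k) j) :=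
    fun k j => by rw [cc_dL hg, dL_pd (hg.cc i k)]
  have sK : ∀ k j, Sm (pd (cc (etaP x ρ b) i k) j) := fun k j => (hg.cc i k).pd j
  have pK : ∀ k j, Supp x ρ (pd (cc (etaP x ρ b) i k) j) := fun k j => (hs.cc i k).pd j
  simp only [e]
  have ii : ∀ k j, Integrable (fun y => U j y * U k y * dL α (pd (cc (etaP x ρ b) i k) j) y) :=
    fun k j => (((pK k j).dL α).mul_left _).integrable
      (((hU j).continuous.mul (hU k).continuous).mul ((sK k j).dL α).continuous)
  rw [integral_finsetSum _ fun k _ => integrable_finsetSum _ fun j _ => ii k j]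
  have hb1 : ∀ k j, |∫ y, U j y * U k y * dL α (pd (cc (etaP x ρ b) i k) j) y| ≤ C * M := by
    intro k j
    have sV : Sm (fun y => U j y * U k y) := (hU j).mul (hU k)
    rw [integral_mul_dL sV (sK k j) (pK k j), abs_mul, abs_pow, abs_neg, abs_one, one_pow, one_mul]
    have hc : Continuous (fun y => |dL α (fun y => U j y * U k y) y| * (C * mm x b y ^ 4)) :=
      (sV.dL α).continuous.abs.mul (continuous_const.mul ((continuous_mm x hb.le).pow 4))
    refine (abs_integral_mul_le (pK k j)
      (fun y _ => hC x y ρ b hρ hb hbρ i k j)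
      (hc.continuousOn.integrableOn_compact (isCompact_closedBall x ρ))).trans ?_
    have : ∀ y, |dL α (fun y => U j y * U k y) y| * (C * mm x b y ^ 4) =
      C * (|dL α (fun y => U j y * U k y) y| * mm x b y ^ 4) := fun y => by ring
    simp only [this]
    rw [integral_const_mul]
    exact mul_le_mul_of_nonneg_left (hM j k) hC0
  calc _ ≤ ∑ k, |∫ y, ∑ j, U j y * U k y * dL α (pd (cc (etaP x ρ b) i k) j) y| :=
        Finset.abs_sum_le_sum_abs _ _
    _ ≤ ∑ _k : Fin 3, ∑ _j : Fin 3, C * M := Finset.sum_le_sum fun k _ => by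
        rw [integral_finsetSum _ fun j _ => ii k j]
        exact (Finset.abs_sum_le_sum_abs _ _).trans (Finset.sum_le_sum fun j _ => hb1 k j)
    _ = _ := by simp; ring

lemma exists_dyadic {ρ r : ℝ} (hr : 0 < r) (h : r ≤ ρ) :
    ∃ n : ℕ, r ≤ ρ * 2⁻¹ ^ n ∧ ρ * 2⁻¹ ^ n ≤ 2 * r := by
  have hρ : 0 < ρ := hr.trans_le h
  obtain ⟨n, h1, h2⟩ := exists_nat_pow_near_of_lt_one (y := (2⁻¹ : ℝ)) (x := r / ρ)
    (by positivity) (by rwa [div_le_one hρ]) (by norm_num) (by norm_num)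
  rw [lt_div_iff₀ hρ] at h1
  rw [div_le_iff₀ hρ] at h2
  refine ⟨n, by linarith, ?_⟩
  rw [pow_succ] at h1
  linarith

lemma dyadic_bound : ∃ C : ℝ, 0 ≤ C ∧ ∀ (x : E3) (ρ Γ : ℝ) (S : E3 → ℝ), 0 < ρ → 0 ≤ Γ →
    Continuous S → (∀ y, 0 ≤ S y) →
    (∀ r, 0 < r → r ≤ ρ → ∫ y in closedBall x r, S y ≤ Γ * r ^ (7 / 3 : ℝ)) →
    ∀ b, 0 < b → ∫ y in closedBall x ρ, S y * mm x b y ^ 4 ≤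
      C * (b ^ (9 / 5 : ℝ) * (Γ * ρ ^ (2 / 15 : ℝ))) := by
  set q : ℝ := 2⁻¹ ^ (2 / 15 : ℝ) with hq
  have hq0 : 0 ≤ q := by positivity
  have hq1 : q < 1 := rpow_lt_one (by norm_num) (by norm_num) (by norm_num)
  refine ⟨2 ^ (11 / 5 : ℝ) * (1 - q)⁻¹, by have := sub_pos.2 hq1; positivity,
    fun x ρ Γ S hρ hΓ hS hS0 h b hb => ?_⟩
  set a : ℕ → ℝ := fun n => b ^ (9 / 5 : ℝ) *
    (2 ^ (11 / 5 : ℝ) * (ρ * 2⁻¹ ^ n) ^ (-(11 / 5) : ℝ)) with ha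
  have ha0 : ∀ n, 0 ≤ a n := fun n => by positivity
  have hm := fun y => mm_nonneg x hb.le y
  have hpt : ∀ y ∈ closedBall x ρ, y ≠ x → ENNReal.ofReal (S y * mm x b y ^ 4) ≤
      ∑' n, (closedBall x (ρ * 2⁻¹ ^ n)).indicator (fun y => ENNReal.ofReal (a n * S y)) y := by
    intro y hy hyx
    have hz : 0 < ‖y - x‖ := norm_pos_iff.2 (sub_ne_zero.2 hyx)
    rw [mem_closedBall, dist_eq_norm] at hy
    obtain ⟨n, h1, h2⟩ := exists_dyadic hz hy
    refine le_trans ?_ (ENNReal.le_tsum n)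
    rw [indicator_of_mem (by rwa [mem_closedBall, dist_eq_norm])]
    refine ENNReal.ofReal_le_ofReal ?_
    rw [mul_comm]
    refine mul_le_mul_of_nonneg_right ?_ (hS0 y)
    have e4 : mm x b y ^ 4 = mm x b y ^ (9 / 5 : ℝ) * mm x b y ^ (11 / 5 : ℝ) := by
      rw [← rpow_add' (hm y) (by norm_num), ← rpow_natCast]; norm_num
    rw [e4, ha]
    have h3 : mm x b y ≤ 2 * (ρ * 2⁻¹ ^ n)⁻¹ := by
      have := mm_mul_le x y hb.le
      rw [← div_eq_mul_inv, le_div_iff₀ (by positivity)]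
      nlinarith [hm y]
    calc _ ≤ b ^ (9 / 5 : ℝ) * (2 * (ρ * 2⁻¹ ^ n)⁻¹) ^ (11 / 5 : ℝ) := by
          gcongr
          · exact rpow_nonneg (hm y) _
          · exact hm y
          · exact mm_le x y hb.le
          · exact hm y
      _ = _ := by
          rw [mul_rpow (by norm_num) (by positivity), inv_rpow (by positivity),
            ← rpow_neg (by positivity)]
  have hc : Continuous (fun y => S y * mm x b y ^ 4) := hS.mul ((continuous_mm x hb.le).pow 4)
  have hn : ∀ n, a n * (Γ * (ρ * 2⁻¹ ^ n) ^ (7 / 3 : ℝ)) =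
      2 ^ (11 / 5 : ℝ) * (b ^ (9 / 5 : ℝ) * (Γ * ρ ^ (2 / 15 : ℝ))) * q ^ n := by
    intro n
    have e1 : (ρ * 2⁻¹ ^ n) ^ (-(11 / 5) : ℝ) * (ρ * 2⁻¹ ^ n) ^ (7 / 3 : ℝ) =
        ρ ^ (2 / 15 : ℝ) * q ^ n := by
      rw [← rpow_add (by positivity), mul_rpow hρ.le (by positivity), hq, ← rpow_natCast,
        ← rpow_natCast, ← rpow_mul (by positivity), ← rpow_mul (by positivity)]
      norm_num
      left; ring_nf
    simp only [ha]
    linear_combination (b ^ (9 / 5 : ℝ) * 2 ^ (11 / 5 : ℝ) * Γ) * e1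
  have hI : ENNReal.ofReal (∫ y in closedBall x ρ, S y * mm x b y ^ 4) ≤ ENNReal.ofReal
      (2 ^ (11 / 5 : ℝ) * (1 - q)⁻¹ * (b ^ (9 / 5 : ℝ) * (Γ * ρ ^ (2 / 15 : ℝ)))) := by
    rw [ofReal_integral_eq_lintegral_ofReal
      (hc.continuousOn.integrableOn_compact (isCompact_closedBall x ρ))
      (Eventually.of_forall fun y => mul_nonneg (hS0 y) (pow_nonneg (hm y) 4))]
    calc _ ≤ ∫⁻ y in closedBall x ρ, ∑' n,
          (closedBall x (ρ * 2⁻¹ ^ n)).indicator (fun y => ENNReal.ofReal (a n * S y)) y := by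
          refine lintegral_mono_ae ?_
          have : ∀ᵐ y ∂(volume.restrict (closedBall x ρ)), y ≠ x :=
            ae_restrict_of_ae (by simp [ae_iff])
          filter_upwards [ae_restrict_mem measurableSet_closedBall, this] with y hy hyx
          exact hpt y hy hyx
      _ = ∑' n, ∫⁻ y in closedBall x ρ,
          (closedBall x (ρ * 2⁻¹ ^ n)).indicator (fun y => ENNReal.ofReal (a n * S y)) y := by
          refine lintegral_tsum fun n => ?_
          exact ((ENNReal.continuous_ofReal.comp (continuous_const.mul hS)).measurable.indicator
            measurableSet_closedBall).aemeasurable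
      _ ≤ ∑' n, ENNReal.ofReal
          (2 ^ (11 / 5 : ℝ) * (b ^ (9 / 5 : ℝ) * (Γ * ρ ^ (2 / 15 : ℝ))) * q ^ n) := by
          refine ENNReal.tsum_le_tsum fun n => ?_
          have hr : ρ * 2⁻¹ ^ n ≤ ρ :=
            mul_le_of_le_one_right hρ.le (pow_le_one₀ (by norm_num) (by norm_num))
          calc _ ≤ ∫⁻ y, (closedBall x (ρ * 2⁻¹ ^ n)).indicator
                (fun y => ENNReal.ofReal (a n * S y)) y :=
                  lintegral_mono' Measure.restrict_le_self le_rfl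
            _ = ∫⁻ y in closedBall x (ρ * 2⁻¹ ^ n), ENNReal.ofReal (a n * S y) :=
                lintegral_indicator measurableSet_closedBall _
            _ = ENNReal.ofReal (∫ y in closedBall x (ρ * 2⁻¹ ^ n), a n * S y) := by
                rw [ofReal_integral_eq_lintegral_ofReal]
                · exact (continuous_const.mul hS).continuousOn.integrableOn_compact
                    (isCompact_closedBall x _)
                · exact Eventually.of_forall fun y => mul_nonneg (ha0 n) (hS0 y)
            _ ≤ _ := by
                rw [← hn n, integral_const_mul]
                exact ENNReal.ofReal_le_ofReal
                  (mul_le_mul_of_nonneg_left (h _ (by positivity) hr) (ha0 n))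
      _ = _ := by
          rw [← ENNReal.ofReal_tsum_of_nonneg (fun n => by positivity)
            ((summable_geometric_of_lt_one hq0 hq1).mul_left _), tsum_mul_left,
            tsum_geometric_of_lt_one hq0 hq1]
          congr 1; ring
  have := sub_pos.2 hq1
  exact (ENNReal.ofReal_le_ofReal_iff (by positivity)).1 hI

/-! ### The representation inequality -/

lemma lap_add {f g : E3 → ℝ} (hf : Sm f) (hg : Sm g) :
    lap (fun y => f y + g y) = fun y => lap f y + lap g y := by
  ext y
  simp only [lap]
  rw [← Finset.sum_add_distrib]
  refine Finset.sum_congr rfl fun i _ => ?_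
  rw [show (fun y => pd (fun y => f y + g y) i y) = fun y => pd f i y + pd g i y from pd_add hf hg i,
    pd_add (hf.pd i) (hg.pd i)]

lemma lap_const_mul {f : E3 → ℝ} (hf : Sm f) (c : ℝ) :
    lap (fun y => c * f y) = fun y => c * lap f y := by
  ext y
  simp only [lap]
  rw [Finset.mul_sum]
  refine Finset.sum_congr rfl fun i _ => ?_
  rw [show (fun y => pd (fun y => c * f y) i y) = fun y => c * pd f i y from pd_const_mul hf c i,
    pd_const_mul (hf.pd i)]

lemma dL_qq (x : E3) (ρ b : ℝ) (l : List (Fin 3)) (y : E3) :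
    dL l (qq x ρ b) y = b ^ 3 / 2 * dL l (etaE x ρ b) y + lap (dL l (etaP x ρ b)) y := by
  have h1 : Sm (etaE x ρ b) := (smJ_etaE x ρ).sm b
  have h2 : Sm (etaP x ρ b) := (smJ_etaP x ρ).sm b
  rw [dL_lap h2, ← congr_fun (dL_const_mul h1 (b ^ 3 / 2) l) y,
    ← congr_fun (dL_add (contDiff_const.mul h1) h2.lap l) y]
  rfl

lemma dL_lap_qq (x : E3) (ρ b : ℝ) (l : List (Fin 3)) (y : E3) :
    dL l (lap (qq x ρ b)) y =
      b ^ 3 / 2 * lap (dL l (etaE x ρ b)) y + lap (lap (dL l (etaP x ρ b))) y := by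
  have h1 : Sm (etaE x ρ b) := (smJ_etaE x ρ).sm b
  have h2 : Sm (etaP x ρ b) := (smJ_etaP x ρ).sm b
  rw [← dL_lap ((smJ_qq x ρ).sm b), funext (dL_qq x ρ b l),
    lap_add (contDiff_const.mul (h1.dL l)) (h2.dL l).lap, lap_const_mul (h1.dL l)]

lemma integral_sub_rpow (t : ℝ) {ρ : ℝ} (hρ : 0 < ρ) :
    IntervalIntegrable (fun s => (t - s) ^ (-(9 / 10) : ℝ)) volume (t - ρ ^ 2) t ∧
    ∫ s in (t - ρ ^ 2)..t, (t - s) ^ (-(9 / 10) : ℝ) = 10 * ρ ^ (1 / 5 : ℝ) := by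
  constructor
  · have := (intervalIntegral.intervalIntegrable_rpow' (r := -(9 / 10)) (a := ρ ^ 2) (b := 0)
      (by norm_num)).comp_sub_left t
    simpa using this
  · rw [intervalIntegral.integral_comp_sub_left (fun s => s ^ (-(9 / 10) : ℝ)), sub_self,
      sub_sub_cancel, integral_rpow (Or.inl (by norm_num)), ← rpow_natCast, ← rpow_mul hρ.le]
    norm_num
    ring

lemma rep_approx (n : ℕ) : ∃ C : ℝ, 0 ≤ C ∧ ∀ (u : ℝ → E3 → E3) (q : ℝ → E3 → ℝ),
    IsNSSol u q (Icc 0 1) → ∀ (t ρ κ : ℝ) (x : E3), 0 < ρ → ρ ^ 2 ≤ t → t ≤ 1 → 0 < κ →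
    κ ≤ ρ ^ 2 → ∀ (γ β : List (Fin 3)) (i : Fin 3), γ.length = n → ∀ X Γ : ℝ, 0 ≤ Γ →
    (∀ s ∈ Icc (t - ρ ^ 2) t, ∫ y in closedBall x ρ, |dL β (comp u i s) y| ≤ X) →
    (∀ s ∈ Icc (t - ρ ^ 2) t, ∀ j k r, 0 < r → r ≤ ρ →
      ∫ y in closedBall x r, |dL (γ ++ β) (fun y => comp u j s y * comp u k s y) y| ≤
        Γ * r ^ (7 / 3 : ℝ)) →
    |∫ y, comp u i t y * ((√κ)⁻¹ ^ 3 / 2 * dL (γ ++ β) (etaE x ρ (√κ)⁻¹) y)| ≤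
      C * (ρ⁻¹ ^ (n + 3) * X + ρ ^ (1 / 3 : ℝ) * Γ) := by
  obtain ⟨C1, h1, hC1⟩ := dL_qq_bound n
  obtain ⟨C2, h2, hC2⟩ := dL_lap_etaP_bound n
  obtain ⟨C3, h3, hC3⟩ := dL_qq_bound (n + 2)
  obtain ⟨C4, h4, hC4⟩ := nonlinear_pairing
  obtain ⟨C5, h5, hC5⟩ := dyadic_bound
  refine ⟨C1 + C2 + 3 * C3 + 10 * (C4 * C5), by positivity,
    fun u q hu t ρ κ x hρ ht0 ht1 hκ hκρ γ β i hγ X Γ hΓ hX hP => ?_⟩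
  set α := γ ++ β with hα
  let b : ℝ → ℝ := fun s => (√(t + κ - min s t))⁻¹
  have hpos : ∀ s, 0 < t + κ - min s t := fun s => by linarith [min_le_right s t]
  have hbpos : ∀ s, 0 < b s := fun s => inv_pos.2 (sqrt_pos.2 (hpos s))
  have hbc : Continuous b := by
    refine Continuous.inv₀ (by fun_prop) fun s => (sqrt_pos.2 (hpos s)).ne'
  have hbd : ∀ s ∈ Ioo (t - ρ ^ 2) t, HasDerivAt b (b s ^ 3 / 2) s := by
    intro s hs
    have e : (fun s => (√(t + κ - s))⁻¹) =ᶠ[𝓝 s] b := by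
      filter_upwards [Iio_mem_nhds hs.2] with z hz
      simp only [b, min_eq_left (mem_Iio.1 hz).le]
    have hp : 0 < t + κ - s := by linarith [hs.2]
    have hs0 := sqrt_pos.2 hp
    refine HasDerivAt.congr_of_eventuallyEq ?_ e.symm
    refine ((((hasDerivAt_id s).const_sub (t + κ)).sqrt hp.ne').inv hs0.ne').congr_deriv ?_
    simp only [b, min_eq_left hs.2.le, id]
    field_simp
  have hρ2 : 0 < ρ ^ 2 := by positivity
  have ht00 : 0 ≤ t - ρ ^ 2 := by linarith
  have htt : t - ρ ^ 2 ≤ t := by linarith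
  have hbρ : ∀ s ∈ Icc (t - ρ ^ 2) t, 1 ≤ 2 * b s * ρ := by
    intro s hs
    simp only [b, min_eq_left hs.2]
    have : √(t + κ - s) ≤ 2 * ρ := by
      rw [sqrt_le_left (by positivity)]; nlinarith [hs.1]
    have hp : 0 < √(t + κ - s) := sqrt_pos.2 (by linarith [hs.2])
    rw [mul_right_comm, ← div_eq_mul_inv, one_le_div hp]
    exact this
  have hm0 : t - ρ ^ 2 ∈ Icc (t - ρ ^ 2) t := ⟨le_rfl, htt⟩
  have hm1 : t ∈ Icc (t - ρ ^ 2) t := ⟨htt, le_rfl⟩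
  have hX0 : 0 ≤ X := (integral_nonneg fun y => abs_nonneg _).trans (hX t hm1)
  have sv : ∀ s, Sm (comp u i s) := fun s => (hu.smJ i).sm s
  have wid := weak_identity hu ht00 htt ht1 (H := fun b => dL α (etaP x ρ b)) ((smJ_etaP x ρ).dL α)
    (fun b => (supp_etaP x hρ b).dL α) hbc (b' := fun s => b s ^ 3 / 2)
    ((hbc.pow 3).div_const 2) hbd i
  rw [dt_dL (smJ_etaP x ρ), dt_etaP] at wid
  simp only [← dL_lap_qq] at wid
  have hbt : b t = (√κ)⁻¹ := by simp [b]
  have eq1 : ∫ y, comp u i t y * ((√κ)⁻¹ ^ 3 / 2 * dL α (etaE x ρ (√κ)⁻¹) y) =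
      (∫ y, comp u i t y * dL α (qq x ρ (b t)) y) -
        ∫ y, comp u i t y * lap (dL α (etaP x ρ (b t))) y := by
    have i1 : Integrable fun y => comp u i t y * dL α (qq x ρ (b t)) y :=
      (((supp_qq x hρ (b t)).dL α).mul_left _).integrable
        ((sv t).continuous.mul (((smJ_qq x ρ).sm (b t)).dL α).continuous)
    have i2 : Integrable fun y => comp u i t y * lap (dL α (etaP x ρ (b t))) y :=
      (((supp_etaP x hρ (b t)).dL α).lap.mul_left _).integrable
        ((sv t).continuous.mul (((smJ_etaP x ρ).sm (b t)).dL α).lap.continuous)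
    rw [← integral_sub i1 i2]
    refine integral_congr_ae (Eventually.of_forall fun y => ?_)
    simp only [dL_qq, hbt]
    ring
  have eq2 : ∫ y, comp u i (t - ρ ^ 2) y * lap (dL α (etaP x ρ (b (t - ρ ^ 2)))) y =
      ∫ y, comp u i (t - ρ ^ 2) y * dL α (lap (etaP x ρ (b (t - ρ ^ 2)))) y := by
    rw [dL_lap ((smJ_etaP x ρ).sm _)]
  have B1 : |∫ y, comp u i t y * dL α (qq x ρ (b t)) y| ≤ C1 * (ρ⁻¹ ^ (n + 3) * X) := by
    refine (pairing (sv t) ((smJ_qq x ρ).sm _) (supp_qq x hρ _) γ β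
      (B := C1 * ρ⁻¹ ^ (n + 3)) fun y => hC1 x y ρ _ hρ (hbpos t) (hbρ t hm1) γ hγ).trans ?_
    rw [mul_assoc]
    gcongr
    exact hX t hm1
  have hb0 : b (t - ρ ^ 2) ≤ ρ⁻¹ := by
    simp only [b, min_eq_left htt]
    refine inv_anti₀ hρ (le_sqrt_of_sq_le (by linarith))
  have B2 : |∫ y, comp u i (t - ρ ^ 2) y * dL α (lap (etaP x ρ (b (t - ρ ^ 2)))) y| ≤
      C2 * (ρ⁻¹ ^ (n + 3) * X) := by
    refine (pairing (sv _) ((smJ_etaP x ρ).sm _).lap (supp_etaP x hρ _).lap γ β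
      (B := C2 * ρ⁻¹ ^ (n + 3)) fun y =>
        (hC2 x y ρ _ hρ (hbpos _) (hbρ _ hm0) γ hγ).trans ?_).trans ?_
    · have := mm_nonneg x (hbpos (t - ρ ^ 2)).le y
      have := (mm_le x y (hbpos (t - ρ ^ 2)).le).trans hb0
      gcongr
    · rw [mul_assoc]
      gcongr
      exact hX _ hm0
  have B3 : ∀ s ∈ Icc (t - ρ ^ 2) t, |∫ y, comp u i s y * dL α (lap (qq x ρ (b s))) y| ≤
      3 * C3 * (ρ⁻¹ ^ (n + 5) * X) := by
    intro s hs
    refine (pairing (sv s) ((smJ_qq x ρ).sm _).lap (supp_qq x hρ _).lap γ β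
      (B := 3 * (C3 * ρ⁻¹ ^ (n + 5))) fun y => abs_dL_lap_le (fun m hm =>
        hC3 x y ρ _ hρ (hbpos s) (hbρ s hs) m (by rw [hm, hγ])) ((smJ_qq x ρ).sm _)).trans ?_
    rw [← mul_assoc 3, mul_assoc (3 * C3)]
    gcongr
    exact hX s hs
  have B4 : ∀ s ∈ Icc (t - ρ ^ 2) t, s ≠ t →
      |∫ y, ∑ k, ∑ j, comp u j s y * comp u k s y * pd (cc (dL α (etaP x ρ (b s))) i k) j y| ≤
      C4 * C5 * (Γ * ρ ^ (2 / 15 : ℝ)) * (t - s) ^ (-(9 / 10) : ℝ) := by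
    intro s hs hst
    have hlt : s < t := lt_of_le_of_ne hs.2 hst
    have hbs : b s ^ (9 / 5 : ℝ) ≤ (t - s) ^ (-(9 / 10) : ℝ) := by
      simp only [b, min_eq_left hs.2]
      rw [sqrt_eq_rpow, ← rpow_neg (by linarith), ← rpow_mul (by linarith)]
      norm_num
      exact rpow_le_rpow_of_nonpos (by linarith) (by linarith) (by norm_num)
    have sV : ∀ j k, Sm (fun y => comp u j s y * comp u k s y) := fun j k =>
      ((hu.smJ j).sm s).mul ((hu.smJ k).sm s)
    refine (hC4 x ρ (b s) hρ (hbpos s) (hbρ s hs) (fun k => comp u k s)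
      (fun k => (hu.smJ k).sm s) α i _ fun j k => hC5 x ρ Γ _ hρ hΓ
        ((sV j k).dL α).continuous.abs (fun y => abs_nonneg _)
        (fun r hr hrρ => hP s hs j k r hr hrρ) (b s) (hbpos s)).trans ?_
    calc _ ≤ C4 * (C5 * ((t - s) ^ (-(9 / 10) : ℝ) * (Γ * ρ ^ (2 / 15 : ℝ)))) := by gcongr
      _ = _ := by ring
  obtain ⟨hi1, hi2⟩ := integral_sub_rpow t hρ
  have B5 : |∫ s in (t - ρ ^ 2)..t, (- (∫ y, comp u i s y * dL α (lap (qq x ρ (b s))) y) +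
      ∫ y, ∑ k, ∑ j, comp u j s y * comp u k s y * pd (cc (dL α (etaP x ρ (b s))) i k) j y)| ≤
      3 * C3 * (ρ⁻¹ ^ (n + 3) * X) + 10 * (C4 * C5) * (ρ ^ (1 / 3 : ℝ) * Γ) := by
    have hg : IntervalIntegrable (fun s => 3 * C3 * (ρ⁻¹ ^ (n + 5) * X) +
      C4 * C5 * (Γ * ρ ^ (2 / 15 : ℝ)) * (t - s) ^ (-(9 / 10) : ℝ)) volume (t - ρ ^ 2) t :=
      intervalIntegrable_const.add (hi1.const_mul _)
    rw [← norm_eq_abs]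
    refine (intervalIntegral.norm_integral_le_of_norm_le htt ?_ hg).trans (le_of_eq ?_)
    · have : ∀ᵐ s : ℝ, s ≠ t := by simp [ae_iff]
      filter_upwards [this] with s hst hs
      have hs' : s ∈ Icc (t - ρ ^ 2) t := ⟨hs.1.le, hs.2⟩
      refine (norm_add_le _ _).trans ?_
      rw [norm_neg]
      exact add_le_add (B3 s hs') (B4 s hs' hst)
    · rw [intervalIntegral.integral_add intervalIntegrable_const (hi1.const_mul _),
        intervalIntegral.integral_const_mul (C4 * C5 * _), hi2, intervalIntegral.integral_const]
      have e1 : ρ ^ (1 / 3 : ℝ) = ρ ^ (1 / 5 : ℝ) * ρ ^ (2 / 15 : ℝ) := by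
        rw [← rpow_add hρ]; norm_num
      have e2 : ρ ^ 2 * ρ⁻¹ ^ (n + 5) = ρ⁻¹ ^ (n + 3) := by
        rw [show n + 5 = (n + 3) + 2 from rfl, pow_add _ (n + 3) 2]
        field_simp
      rw [sub_sub_cancel, e1, ← e2, smul_eq_mul]
      ring
  rw [eq1]
  beta_reduce at wid
  rw [eq2] at wid
  rw [← wid] at B5
  rw [abs_le] at *
  have hr : 0 ≤ ρ⁻¹ ^ (n + 3) * X := by positivity
  have hr' : 0 ≤ ρ ^ (1 / 3 : ℝ) * Γ := by positivity
  have : 0 ≤ (C1 + C2 + 3 * C3) * (ρ ^ (1 / 3 : ℝ) * Γ) := by positivity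
  have : 0 ≤ 10 * (C4 * C5) * (ρ⁻¹ ^ (n + 3) * X) := by positivity
  constructor <;> nlinarith [B1.1, B1.2, B2.1, B2.2, B5.1, B5.2]

/-- The total mass of the Gaussian profile. -/
def gaussMass : ℝ := ∫ z : E3, exp (-(1 / 4) * ‖z‖ ^ 2)

lemma gaussMass_pos : 0 < gaussMass := by
  rw [gaussMass, GaussianFourier.integral_rexp_neg_mul_sq_norm (by norm_num)]
  positivity

lemma gaussian_tendsto {g : E3 → ℝ} (hg : Integrable g) (hc : Continuous g) (x : E3) :
    Tendsto (fun b : ℝ => ∫ y, b ^ 3 * EE x b y * g y) atTop (𝓝 (gaussMass * g x)) := by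
  have hm := gaussMass_pos
  have key := tendsto_integral_comp_smul_smul_of_integrable' (μ := (volume : Measure E3))
    (φ := fun z : E3 => gaussMass⁻¹ * exp (-(1 / 4) * ‖z‖ ^ 2)) (fun z => by positivity)
    (by rw [integral_const_mul, ← gaussMass, inv_mul_cancel₀ hm.ne'])
    (by
      have h1 := tendsto_rpow_mul_exp_neg_mul_atTop_nhds_zero (3 / 2) (1 / 4) (by norm_num)
      have h2 : Tendsto (fun z : E3 => ‖z‖ ^ 2) (Bornology.cobounded E3) atTop :=
        (tendsto_pow_atTop (by norm_num)).comp tendsto_norm_cobounded_atTop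
      have h3 := (h1.comp h2).const_mul gaussMass⁻¹
      rw [mul_zero] at h3
      refine h3.congr fun z => ?_
      have : (‖z‖ ^ 2) ^ (3 / 2 : ℝ) = ‖z‖ ^ 3 := by
        rw [← rpow_natCast, ← rpow_mul (norm_nonneg z), ← rpow_natCast]; norm_num
      simp only [Function.comp, this, finrank_euclideanSpace, Fintype.card_fin]
      ring)
    hg hc.continuousAt (x₀ := x)
  refine (key.const_mul gaussMass).congr' ?_
  filter_upwards [eventually_gt_atTop 0] with b hb
  rw [← integral_const_mul]
  refine integral_congr_ae (Eventually.of_forall fun y => ?_)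
  have : -(1 / 4) * ‖b • (x - y)‖ ^ 2 = -(b ^ 2 * ‖y - x‖ ^ 2 / 4) := by
    rw [norm_smul, norm_sub_rev, mul_pow, norm_eq_abs, sq_abs]; ring
  simp only [this, finrank_euclideanSpace, Fintype.card_fin, smul_eq_mul, EE]
  field_simp

lemma rep_bound (n : ℕ) : ∃ C : ℝ, 0 ≤ C ∧ ∀ (u : ℝ → E3 → E3) (q : ℝ → E3 → ℝ),
    IsNSSol u q (Icc 0 1) → ∀ (t ρ : ℝ) (x : E3), 0 < ρ → ρ ^ 2 ≤ t → t ≤ 1 →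
    ∀ (γ β : List (Fin 3)) (i : Fin 3), γ.length = n → ∀ X Γ : ℝ, 0 ≤ Γ →
    (∀ s ∈ Icc (t - ρ ^ 2) t, ∫ y in closedBall x ρ, |dL β (comp u i s) y| ≤ X) →
    (∀ s ∈ Icc (t - ρ ^ 2) t, ∀ j k r, 0 < r → r ≤ ρ →
      ∫ y in closedBall x r, |dL (γ ++ β) (fun y => comp u j s y * comp u k s y) y| ≤
        Γ * r ^ (7 / 3 : ℝ)) →
    |dL (γ ++ β) (comp u i t) x| ≤ C * (ρ⁻¹ ^ (n + 3) * X + ρ ^ (1 / 3 : ℝ) * Γ) := by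
  obtain ⟨C, hC0, hC⟩ := rep_approx n
  have hm := gaussMass_pos
  refine ⟨2 * gaussMass⁻¹ * C, by positivity,
    fun u q hu t ρ x hρ ht0 ht1 γ β i hγ X Γ hΓ hX hP => ?_⟩
  have sv : Sm (comp u i t) := (hu.smJ i).sm t
  set α := γ ++ β
  have sη : Sm (eta x ρ) := sm_eta x ρ
  have pη : Supp x ρ (fun y => dL α (comp u i t) y * eta x ρ y) := (supp_eta x hρ).mul_left _
  have cη : Continuous (fun y => dL α (comp u i t) y * eta x ρ y) :=
    (sv.dL α).continuous.mul sη.continuous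
  have lim := (gaussian_tendsto (pη.integrable cη) cη x).abs
  rw [eta_eq_one hρ (mem_closedBall_self (by positivity)), mul_one] at lim
  have hev : ∀ᶠ b : ℝ in atTop, |∫ y, b ^ 3 * EE x b y * (dL α (comp u i t) y * eta x ρ y)| ≤
      2 * (C * (ρ⁻¹ ^ (n + 3) * X + ρ ^ (1 / 3 : ℝ) * Γ)) := by
    filter_upwards [eventually_ge_atTop ρ⁻¹] with b hb
    have hb0 : 0 < b := (inv_pos.2 hρ).trans_le hb
    have hbi : b⁻¹ ≤ ρ := inv_le_of_inv_le₀ hρ hb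
    have h := hC u q hu t ρ (b⁻¹ ^ 2) x hρ ht0 ht1 (by positivity)
      (by gcongr) γ β i hγ X Γ hΓ hX hP
    rw [sqrt_sq (by positivity), inv_inv] at h
    have sE : Sm (etaE x ρ b) := (smJ_etaE x ρ).sm b
    have e1 : ∫ y, comp u i t y * (b ^ 3 / 2 * dL α (etaE x ρ b) y) =
        b ^ 3 / 2 * ((-1) ^ α.length * ∫ y, dL α (comp u i t) y * etaE x ρ b y) := by
      rw [← integral_mul_dL sv sE (supp_etaE x hρ b) α, ← integral_const_mul]
      refine integral_congr_ae (Eventually.of_forall fun y => ?_)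
      beta_reduce
      ring
    have e2 : ∫ y, b ^ 3 * EE x b y * (dL α (comp u i t) y * eta x ρ y) =
        b ^ 3 * ∫ y, dL α (comp u i t) y * etaE x ρ b y := by
      rw [← integral_const_mul]
      refine integral_congr_ae (Eventually.of_forall fun y => ?_)
      simp only [etaE]
      ring
    rw [e1, abs_mul, abs_mul, abs_pow, abs_neg, abs_one, one_pow, one_mul, abs_div, abs_two] at h
    rw [e2, abs_mul]
    linarith
  have := le_of_tendsto lim hev
  rw [abs_mul, abs_of_pos hm] at this
  calc |dL α (comp u i t) x| = gaussMass⁻¹ * (gaussMass * |dL α (comp u i t) x|) := by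
        field_simp
    _ ≤ gaussMass⁻¹ * (2 * (C * (ρ⁻¹ ^ (n + 3) * X + ρ ^ (1 / 3 : ℝ) * Γ))) := by gcongr
    _ = _ := by ring

/-! ### Weak bounds on small balls for axisymmetric fields -/

lemma meas_le_of_wnorm3 {U : E3 → E3} {A : ℝ} (hA : 0 ≤ A) (h : wnorm3 U ≤ ENNReal.ofReal A)
    {l : ℝ} (hl : 0 < l) : volume {x | l ≤ ‖U x‖} ≤ ENNReal.ofReal (A ^ 3 * l⁻¹ ^ 3) := by
  have h1 : ENNReal.ofReal l * (volume {x : E3 | l ≤ ‖U x‖}) ^ (1 / 3 : ℝ) ≤ ENNReal.ofReal A :=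
    (le_iSup₂_of_le (f := fun (l : ℝ) (_ : 0 < l) =>
      ENNReal.ofReal l * (volume {x : E3 | l ≤ ‖U x‖}) ^ (1 / 3 : ℝ)) l hl le_rfl).trans h
  have h2 : (volume {x : E3 | l ≤ ‖U x‖}) ^ (1 / 3 : ℝ) ≤ ENNReal.ofReal (A * l⁻¹) := by
    rw [← div_eq_mul_inv, ENNReal.ofReal_div_of_pos hl, ENNReal.le_div_iff_mul_le
      (Or.inl (by simpa using hl)) (Or.inl ENNReal.ofReal_ne_top), mul_comm]
    exact h1
  calc _ = ((volume {x : E3 | l ≤ ‖U x‖}) ^ (1 / 3 : ℝ)) ^ 3 := by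
        rw [← ENNReal.rpow_natCast, ← ENNReal.rpow_mul]; norm_num
    _ ≤ ENNReal.ofReal (A * l⁻¹) ^ 3 := by gcongr
    _ = _ := by rw [← ENNReal.ofReal_pow (by positivity), mul_pow]

lemma rotZ_apply (θ : ℝ) (x : E3) : rotZ θ x 0 = x 0 * cos θ - x 1 * sin θ ∧
    rotZ θ x 1 = x 0 * sin θ + x 1 * cos θ ∧ rotZ θ x 2 = x 2 := ⟨rfl, rfl, rfl⟩

lemma norm_sq_E3 (x : E3) : ‖x‖ ^ 2 = x 0 ^ 2 + x 1 ^ 2 + x 2 ^ 2 := by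
  simp [EuclideanSpace.norm_sq_eq, Fin.sum_univ_three]

lemma norm_rotZ (θ : ℝ) (x : E3) : ‖rotZ θ x‖ = ‖x‖ := by
  obtain ⟨h0, h1, h2⟩ := rotZ_apply θ x
  rw [← sq_eq_sq₀ (norm_nonneg _) (norm_nonneg _), norm_sq_E3, norm_sq_E3, h0, h1, h2]
  linear_combination (x 0 ^ 2 + x 1 ^ 2) * sin_sq_add_cos_sq θ

lemma rotZ_sub (θ : ℝ) (x y : E3) : rotZ θ (x - y) = rotZ θ x - rotZ θ y := by
  ext i
  fin_cases i <;> simp [rotZ] <;> ring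

lemma measurePreserving_rotZ (θ : ℝ) : MeasurePreserving (rotZ θ) := by
  let L : E3 →ₗᵢ[ℝ] E3 :=
    { toFun := rotZ θ
      map_add' := fun x y => by ext i; fin_cases i <;> simp [rotZ] <;> ring
      map_smul' := fun c x => by ext i; fin_cases i <;> simp [rotZ] <;> ring
      norm_map' := norm_rotZ θ }
  exact (L.toLinearIsometryEquiv rfl).measurePreserving

lemma dist_rotZ (θ φ : ℝ) (x : E3) :
    dist (rotZ θ x) (rotZ φ x) = 2 * rr x * |sin ((θ - φ) / 2)| := by
  obtain ⟨h0, h1, h2⟩ := rotZ_apply θ x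
  obtain ⟨g0, g1, g2⟩ := rotZ_apply φ x
  have hr : rr x ^ 2 = x 0 ^ 2 + x 1 ^ 2 := sq_sqrt (by positivity)
  have hr0 : 0 ≤ rr x := sqrt_nonneg _
  have e : cos (θ - φ) = 1 - 2 * sin ((θ - φ) / 2) ^ 2 := by
    rw [sin_sq_eq_half_sub, mul_div_cancel₀ _ two_ne_zero]; ring
  rw [cos_sub] at e
  rw [dist_eq_norm, ← sq_eq_sq₀ (norm_nonneg _) (by positivity), norm_sq_E3]
  simp only [PiLp.sub_apply, h0, h1, h2, g0, g1, g2]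
  rw [mul_pow, mul_pow, hr, sq_abs]
  linear_combination (x 0 ^ 2 + x 1 ^ 2) * (sin_sq_add_cos_sq θ + sin_sq_add_cos_sq φ - 2 * e)

lemma axi_distrib {U : E3 → E3} (hU : Continuous U) (hrot : ∀ θ x, U (rotZ θ x) = rotZ θ (U x))
    {A : ℝ} (hA : 0 ≤ A) (h : wnorm3 U ≤ ENNReal.ofReal A) {x : E3} (hx : 0 < rr x) {s : ℝ}
    (hs : 0 < s) {l : ℝ} (hl : 0 < l) :
    volume (closedBall x s ∩ {y | l ≤ ‖U y‖}) ≤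
      ENNReal.ofReal (2 * s * A ^ 3 * (rr x)⁻¹ * l⁻¹ ^ 3) := by
  set R := rr x
  set N := ⌊π * R / (4 * s)⌋₊ + 1 with hN
  let E : ℕ → Set E3 := fun k => closedBall (rotZ (4 * s / R * k) x) s ∩ {y | l ≤ ‖U y‖}
  have mE : ∀ k, MeasurableSet (E k) := fun k =>
    measurableSet_closedBall.inter (isClosed_le continuous_const hU.norm).measurableSet
  have vE : ∀ k, volume (E k) = volume (closedBall x s ∩ {y | l ≤ ‖U y‖}) := by
    intro k
    rw [← (measurePreserving_rotZ (4 * s / R * k)).measure_preimage (mE k).nullMeasurableSet]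
    congr 1
    ext y
    simp only [E, mem_preimage, mem_inter_iff, mem_closedBall, dist_eq_norm, ← rotZ_sub, norm_rotZ,
      mem_ofPred_eq, hrot]
  have hsep : ∀ i < N, ∀ j < N, i < j → Disjoint (E i) (E j) := by
    intro i hi j hj hij
    refine Disjoint.mono inter_subset_left inter_subset_left (closedBall_disjoint_closedBall ?_)
    rw [dist_comm, dist_rotZ]
    have h1 : (1 : ℝ) ≤ j - i := by
      have : ((i + 1 : ℕ) : ℝ) ≤ j := Nat.cast_le.2 hij
      push_cast at this; linarith
    have h2 : (j : ℝ) ≤ π * R / (4 * s) :=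
      (Nat.cast_le.2 (Nat.lt_succ_iff.1 hj)).trans (Nat.floor_le (by positivity))
    have e : (4 * s / R * j - 4 * s / R * i) / 2 = 2 * s / R * (j - i) := by ring
    have hw : 2 * s / R * (j - i) ≤ π / 2 := by
      have : 2 * s / R * (π * R / (4 * s)) = π / 2 := by field_simp; norm_num
      rw [← this]
      gcongr
      linarith [(Nat.cast_nonneg i : (0:ℝ) ≤ i)]
    have hw0 : 0 ≤ 2 * s / R * ((j : ℝ) - i) := by
      have : 0 ≤ (j : ℝ) - i := by linarith
      positivity
    have h3 := mul_le_sin hw0 hw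
    rw [e]
    have h4 : s / R < sin (2 * s / R * (j - i)) := by
      refine lt_of_lt_of_le ?_ h3
      have hp : 1 < 2 / π * 2 := by
        rw [div_mul_eq_mul_div, one_lt_div pi_pos]; linarith [pi_lt_four]
      have hsR : 0 < s / R := by positivity
      calc s / R < (2 / π * 2) * (s / R) := by nlinarith
        _ ≤ (2 / π * 2) * (s / R) * (j - i) := le_mul_of_one_le_right (by positivity) h1
        _ = _ := by ring
    rw [div_lt_iff₀ hx] at h4
    nlinarith [le_abs_self (sin (2 * s / R * (j - i)))]
  have hdisj : Set.PairwiseDisjoint (↑(Finset.range N)) E := by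
    intro i hi j hj hij
    simp only [Finset.coe_range, mem_Iio] at hi hj
    rcases lt_or_gt_of_ne hij with h | h
    · exact hsep i hi j hj h
    · exact (hsep j hj i hi h).symm
  have h1 : N * volume (closedBall x s ∩ {y | l ≤ ‖U y‖}) ≤ ENNReal.ofReal (A ^ 3 * l⁻¹ ^ 3) := by
    calc _ = ∑ k ∈ Finset.range N, volume (E k) := by simp [vE]
      _ = volume (⋃ k ∈ Finset.range N, E k) :=
        (measure_biUnion_finset hdisj fun k _ => mE k).symm
      _ ≤ volume {y | l ≤ ‖U y‖} :=
        measure_mono (iUnion₂_subset fun k _ => inter_subset_right)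
      _ ≤ _ := meas_le_of_wnorm3 hA h hl
  have hN2 : R / (2 * s) ≤ N := by
    have : π * R / (4 * s) < N := by rw [hN]; push_cast; exact Nat.lt_floor_add_one _
    refine le_trans ?_ this.le
    rw [div_le_div_iff₀ (by positivity) (by positivity)]
    have := pi_gt_three
    nlinarith [mul_pos hx hs]
  have hR : 0 < R / (2 * s) := by positivity
  calc _ ≤ ENNReal.ofReal (A ^ 3 * l⁻¹ ^ 3) / ENNReal.ofReal (R / (2 * s)) := by
        rw [ENNReal.le_div_iff_mul_le (Or.inl (by simpa using hR)) (Or.inl ENNReal.ofReal_ne_top),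
          mul_comm]
        refine le_trans ?_ h1
        gcongr
        rw [← ENNReal.ofReal_natCast]
        exact ENNReal.ofReal_le_ofReal hN2
    _ = _ := by
        rw [← ENNReal.ofReal_div_of_pos hR]
        congr 1
        field_simp

lemma lintegral_tail (c : ℝ) {K h a : ℝ} (hK : 0 ≤ K) (hh : 0 < h) (ha : a < -1)
    (hc : K * (-h ^ (a + 1) / (a + 1)) = c) :
    ∫⁻ t in Ioi h, ENNReal.ofReal (K * t ^ a) = ENNReal.ofReal c := by
  rw [← ofReal_integral_eq_lintegral_ofReal ((integrableOn_Ioi_rpow_of_lt ha hh).const_mul K),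
    integral_const_mul, integral_Ioi_rpow_of_lt ha hh, hc]
  filter_upwards [ae_restrict_mem measurableSet_Ioi] with t ht
  have : 0 < t := hh.trans ht
  positivity

lemma axi_integral {U : E3 → E3} (hU : Continuous U) (hrot : ∀ θ x, U (rotZ θ x) = rotZ θ (U x))
    {A : ℝ} (hA : 0 < A) (h : wnorm3 U ≤ ENNReal.ofReal A) {x : E3} (hx : 0 < rr x) {s : ℝ}
    (hs : 0 < s) :
    ∫ y in closedBall x s, ‖U y‖ ≤ 6 * (A * (rr x) ^ (-(1 / 3) : ℝ)) * s ^ (7 / 3 : ℝ) := by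
  set R := rr x
  set b := A * R ^ (-(1 / 3) : ℝ) * s ^ (-(2 / 3) : ℝ) with hb
  have hb0 : 0 < b := by positivity
  have hV : volume (closedBall x s) ≤ ENNReal.ofReal (5 * s ^ 3) := by
    rw [EuclideanSpace.volume_closedBall_fin_three, ← ENNReal.ofReal_pow hs.le,
      ← ENNReal.ofReal_mul (by positivity)]
    refine ENNReal.ofReal_le_ofReal ?_
    rw [mul_comm]
    gcongr
    linarith [pi_lt_d2]
  have e0 : A * R ^ (-(1 / 3) : ℝ) * s ^ (7 / 3 : ℝ) = b * s ^ 3 := by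
    rw [hb, ← rpow_natCast s 3, mul_assoc _ (s ^ _) (s ^ _), ← rpow_add hs]; norm_num
  have e1 : A ^ 3 * R⁻¹ * s = b ^ 2 * (b * s ^ 3) := by
    have r1 : (R ^ (-(1 / 3) : ℝ)) ^ 3 = R⁻¹ := by
      rw [← rpow_natCast, ← rpow_mul hx.le, ← rpow_neg_one]; norm_num
    have s1 : (s ^ (-(2 / 3) : ℝ)) ^ 3 * s ^ 2 = 1 := by
      rw [← rpow_natCast, ← rpow_mul hs.le, ← rpow_natCast, ← rpow_add hs]; norm_num
    calc A ^ 3 * R⁻¹ * s = A ^ 3 * (R ^ (-(1 / 3) : ℝ)) ^ 3 *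
          ((s ^ (-(2 / 3) : ℝ)) ^ 3 * s ^ 2) * s := by rw [r1, s1, mul_one]
      _ = _ := by rw [hb]; ring
  have hI : ENNReal.ofReal (∫ y in closedBall x s, ‖U y‖) ≤
      ENNReal.ofReal (6 * (A * R ^ (-(1 / 3) : ℝ)) * s ^ (7 / 3 : ℝ)) := by
    rw [ofReal_integral_eq_lintegral_ofReal
      (hU.norm.continuousOn.integrableOn_compact (isCompact_closedBall x s))
      (Eventually.of_forall fun y => norm_nonneg _),
      lintegral_eq_lintegral_meas_le _ (Eventually.of_forall fun y => norm_nonneg _)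
        hU.norm.aemeasurable, ← Ioc_union_Ioi_eq_Ioi hb0.le]
    refine (lintegral_union_le _ _ _).trans ?_
    have i1 : ∫⁻ t in Ioc 0 b, (volume.restrict (closedBall x s)) {y | t ≤ ‖U y‖} ≤
        ENNReal.ofReal (5 * (b * s ^ 3)) := by
      calc _ ≤ ∫⁻ t in Ioc 0 b, ENNReal.ofReal (5 * s ^ 3) := by
            refine lintegral_mono fun t => (measure_mono (subset_univ _)).trans ?_
            simpa using hV
        _ = _ := by
            rw [lintegral_const, Measure.restrict_apply_univ, Real.volume_Ioc, sub_zero,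
              ← ENNReal.ofReal_mul (by positivity)]
            congr 1; ring
    have i2 : ∫⁻ t in Ioi b, (volume.restrict (closedBall x s)) {y | t ≤ ‖U y‖} ≤
        ENNReal.ofReal (b * s ^ 3) := by
      calc _ ≤ ∫⁻ t in Ioi b, ENNReal.ofReal (2 * s * A ^ 3 * R⁻¹ * t ^ (-3 : ℝ)) := by
            refine setLIntegral_mono' measurableSet_Ioi fun t ht => ?_
            have ht0 : 0 < t := hb0.trans ht
            rw [Measure.restrict_apply
              (isClosed_le continuous_const hU.norm).measurableSet, inter_comm]
            refine (axi_distrib hU hrot hA.le h hx hs ht0).trans (le_of_eq ?_)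
            rw [rpow_neg ht0.le, inv_pow]; norm_cast
        _ = _ := by
            refine lintegral_tail _ (by positivity) hb0 (by norm_num) ?_
            have : b ^ (-3 + 1 : ℝ) = (b ^ 2)⁻¹ := by
              rw [show (-3 + 1 : ℝ) = -(2 : ℕ) by norm_num, rpow_neg hb0.le, rpow_natCast]
            rw [this]
            calc _ = (A ^ 3 * R⁻¹ * s) * (b ^ 2)⁻¹ := by ring
              _ = _ := by rw [e1]; field_simp
    refine (add_le_add i1 i2).trans (le_of_eq ?_)
    rw [← ENNReal.ofReal_add (by positivity) (by positivity)]
    congr 1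
    linear_combination -6 * e0
  exact (ENNReal.ofReal_le_ofReal_iff (by positivity)).1 hI

/-! ### Selecting a point of controlled growth in a parabolic cylinder -/

lemma exists_good_point {f : ℝ → E3 → ℝ} (hf : Continuous fun z : ℝ × E3 => f z.1 z.2)
    (hf0 : ∀ t x, 0 ≤ f t x) {k : ℕ} (hk : k ≠ 0) {t' ρ' : ℝ} {x' : E3} (hρ : 0 < ρ')
    (hpos : 0 < f t' x') :
    ∃ (t : ℝ) (x : E3) (ρ : ℝ), 0 < ρ ∧ 2 * ρ ≤ ρ' ∧
      (∀ s ∈ Icc (t - ρ ^ 2) t, ∀ y ∈ closedBall x ρ,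
        s ∈ Icc (t' - ρ' ^ 2) t' ∧ y ∈ closedBall x' ρ' ∧ f s y ≤ 2 ^ k * f t x) ∧
      ρ' ^ k * f t' x' ≤ (2 * ρ) ^ k * f t x := by
  let d : ℝ × E3 → ℝ := fun z => ρ' - max (dist z.2 x') √(t' - z.1)
  have hd : Continuous d := by fun_prop
  have hK : IsCompact (Icc (t' - ρ' ^ 2) t' ×ˢ closedBall x' ρ') :=
    isCompact_Icc.prod (isCompact_closedBall x' ρ')
  have hz' : (t', x') ∈ Icc (t' - ρ' ^ 2) t' ×ˢ closedBall x' ρ' :=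
    ⟨⟨by linarith [sq_nonneg ρ'], le_rfl⟩, mem_closedBall_self hρ.le⟩
  obtain ⟨⟨t, x⟩, hz, hmax⟩ := hK.exists_isMaxOn ⟨_, hz'⟩
    (f := fun z => d z ^ k * f z.1 z.2) ((hd.pow k).mul hf).continuousOn
  have hd' : d (t', x') = ρ' := by simp [d]
  have dnn : ∀ z ∈ Icc (t' - ρ' ^ 2) t' ×ˢ closedBall x' ρ', 0 ≤ d z := by
    rintro ⟨s, y⟩ ⟨hs, hy⟩
    refine sub_nonneg.2 (max_le hy ?_)
    rw [sqrt_le_left hρ.le]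
    linarith [hs.1]
  have hm := hmax hz'
  simp only [mem_ofPred_eq, hd'] at hm
  have hgp : 0 < d (t, x) ^ k * f t x := lt_of_lt_of_le (by positivity) hm
  have hd0 : 0 < d (t, x) := by
    refine lt_of_le_of_ne (dnn _ hz) fun h => ?_
    rw [← h, zero_pow hk, zero_mul] at hgp
    exact lt_irrefl _ hgp
  have hle : d (t, x) ≤ ρ' := by
    have : 0 ≤ max (dist x x') √(t' - t) := le_max_of_le_left dist_nonneg
    simp only [d]; linarith
  refine ⟨t, x, d (t, x) / 2, by positivity, by linarith, fun s hs y hy => ?_, ?_⟩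
  · have h1 : dist y x' ≤ dist x x' + d (t, x) / 2 := by
      have := dist_triangle y x x'
      linarith [mem_closedBall.1 hy]
    have h2 : √(t' - s) ≤ √(t' - t) + d (t, x) / 2 := by
      have htt : 0 ≤ t' - t := by linarith [hz.1.2]
      rw [sqrt_le_left (by positivity)]
      nlinarith [sq_sqrt htt, sqrt_nonneg (t' - t), hs.1]
    have h3 : d (t, x) / 2 ≤ d (s, y) := by
      have : max (dist y x') √(t' - s) ≤ max (dist x x') √(t' - t) + d (t, x) / 2 := by
        refine max_le (h1.trans ?_) (h2.trans ?_) <;> gcongr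
        · exact le_max_left _ _
        · exact le_max_right _ _
      simp only [d] at *
      linarith
    have hmem : (s, y) ∈ Icc (t' - ρ' ^ 2) t' ×ˢ closedBall x' ρ' := by
      have h4 : max (dist y x') √(t' - s) ≤ ρ' := by
        have : 0 < d (s, y) := lt_of_lt_of_le (by positivity) h3
        simp only [d] at this
        linarith
      refine ⟨⟨?_, hs.2.trans hz.1.2⟩, (le_max_left _ _).trans h4⟩
      have := (le_max_right _ _).trans h4
      rw [sqrt_le_left hρ.le] at this
      simp only
      linarith
    refine ⟨hmem.1, hmem.2, ?_⟩
    have h5 := hmax hmem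
    simp only [mem_ofPred_eq] at h5
    have h6 : (d (t, x) / 2) ^ k * f s y ≤ (d (t, x) / 2) ^ k * (2 ^ k * f t x) := by
      calc _ ≤ d (s, y) ^ k * f s y := by
            have := hf0 s y
            gcongr
        _ ≤ d (t, x) ^ k * f t x := h5
        _ = _ := by rw [div_pow]; field_simp
    exact le_of_mul_le_mul_left h6 (by positivity)
  · rw [mul_div_cancel₀ _ two_ne_zero]
    exact hm

/-! ### Interior estimates away from the axis -/

lemma rr_nonneg (x : E3) : 0 ≤ rr x := sqrt_nonneg _

lemma rr_le_add_dist (x y : E3) : rr x ≤ rr y + dist x y := by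
  have hy : rr y ^ 2 = y 0 ^ 2 + y 1 ^ 2 := sq_sqrt (by positivity)
  have hd : (x 0 - y 0) ^ 2 + (x 1 - y 1) ^ 2 ≤ dist x y ^ 2 := by
    rw [dist_eq_norm, norm_sq_E3]
    simp only [PiLp.sub_apply]
    linarith [sq_nonneg (x 2 - y 2)]
  have h0 := rr_nonneg y
  have hc : y 0 * (x 0 - y 0) + y 1 * (x 1 - y 1) ≤ rr y * dist x y := by
    refine abs_le_of_sq_le_sq' ?_ (mul_nonneg h0 dist_nonneg) |>.2
    rw [mul_pow, hy]
    nlinarith [sq_nonneg (y 0 * (x 1 - y 1) - y 1 * (x 0 - y 0)), sq_nonneg (y 0), sq_nonneg (y 1)]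
  rw [rr, sqrt_le_left (by positivity)]
  nlinarith

/-- Axisymmetric classical solutions on `[0, 1]` with weak `L³` norm at most `A`. -/
structure AxiSol (u : ℝ → E3 → E3) (q : ℝ → E3 → ℝ) (A : ℝ) : Prop where
  two_le : 2 ≤ A
  sol : IsNSSol u q (Icc 0 1)
  axi : AxiSym u
  weak : ∀ t ∈ Icc (0:ℝ) 1, wnorm3 (u t) ≤ ENNReal.ofReal A

/-- The sum of the absolute values of all derivatives of order `n` of all components. -/
def UU (u : ℝ → E3 → E3) (n : ℕ) (s : ℝ) (y : E3) : ℝ := ∑ i, Nn n (comp u i s) y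

lemma UU_nonneg (u : ℝ → E3 → E3) (n : ℕ) (s : ℝ) (y : E3) : 0 ≤ UU u n s y :=
  Finset.sum_nonneg fun _ _ => Nn_nonneg _ _ _

section

variable {u : ℝ → E3 → E3} {q : ℝ → E3 → ℝ} {A : ℝ}

lemma IsNSSol.continuous_UU {I : Set ℝ} (h : IsNSSol u q I) (n : ℕ) :
    Continuous fun z : ℝ × E3 => UU u n z.1 z.2 :=
  continuous_finsetSum _ fun i _ => (h.smJ i).continuous_Nn n

lemma IsNSSol.abs_dL_le_UU {I : Set ℝ} (h : IsNSSol u q I) (i : Fin 3) (l : List (Fin 3)) {n : ℕ}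
    (hl : l.length = n) (s : ℝ) (y : E3) : |dL l (comp u i s) y| ≤ UU u n s y := by
  subst hl
  have hs : Sm (comp u i s) := (h.smJ i).sm s
  refine ((abs_dL_le hs l y).trans (norm_iteratedFDeriv_le_Nn hs _ y)).trans ?_
  exact Finset.single_le_sum (f := fun i => Nn l.length (comp u i s) y)
    (fun i _ => Nn_nonneg _ _ _) (Finset.mem_univ i)

lemma UU_le {n : ℕ} {s : ℝ} {y : E3} {B : ℝ}
    (hB : ∀ i, ∀ l : List (Fin 3), l.length = n → |dL l (comp u i s) y| ≤ B) :
    UU u n s y ≤ 3 ^ (n + 1) * B := by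
  calc UU u n s y ≤ ∑ _i : Fin 3, 3 ^ n * B := Finset.sum_le_sum fun i _ => Nn_le (hB i)
    _ = _ := by simp; ring

lemma cbrt_mul {a b : ℝ} (ha : 0 < a) (hb : 0 < b) :
    a ^ (1 / 3 : ℝ) * b ^ (-(1 / 3) : ℝ) = (a / b) ^ (1 / 3 : ℝ) := by
  rw [div_rpow ha.le hb.le, rpow_neg hb.le, div_eq_mul_inv (a ^ _)]

lemma exists_le_pow {C : ℝ} : ∃ N : ℕ, ∀ A : ℝ, 2 ≤ A → C ≤ A ^ N := by
  obtain ⟨N, hN⟩ := pow_unbounded_of_one_lt C (one_lt_two)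
  exact ⟨N, fun A hA => hN.le.trans (by gcongr)⟩

/-- The interior estimate of order `n` with constant `A ^ K`. -/
def Interior (n K : ℕ) : Prop := ∀ (u : ℝ → E3 → E3) (q : ℝ → E3 → ℝ) (A : ℝ), AxiSol u q A →
  ∀ (t ρ : ℝ) (x : E3), 0 < ρ → ρ ^ 2 ≤ t → t ≤ 1 → 2 * ρ ≤ rr x →
    ρ ^ (n + 1) * UU u n t x ≤ A ^ K * (ρ / rr x) ^ (1 / 3 : ℝ)

lemma AxiSol.integral_le (h : AxiSol u q A) {s : ℝ} (hs : s ∈ Icc (0:ℝ) 1) {R : ℝ} (hR : 0 < R)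
    {x : E3} (hx : R / 2 ≤ rr x) {r : ℝ} (hr : 0 < r) :
    ∫ y in closedBall x r, ‖u s y‖ ≤ 12 * (A * R ^ (-(1 / 3) : ℝ)) * r ^ (7 / 3 : ℝ) := by
  have hA : 0 < A := by linarith [h.two_le]
  have hc : Continuous (u s) := h.sol.1.continuous.comp (by fun_prop : Continuous fun y => (s, y))
  refine (axi_integral hc (fun θ y => h.axi θ s y) hA (h.weak s hs) (by linarith) hr).trans ?_
  have h1 : rr x ^ (-(1 / 3) : ℝ) ≤ (R / 2) ^ (-(1 / 3) : ℝ) :=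
    rpow_le_rpow_of_nonpos (by positivity) hx (by norm_num)
  have h2 : (R / 2) ^ (-(1 / 3) : ℝ) ≤ 2 * R ^ (-(1 / 3) : ℝ) := by
    rw [div_rpow hR.le (by norm_num), rpow_neg (by norm_num : (0:ℝ) ≤ 2), div_inv_eq_mul, mul_comm]
    gcongr
    calc (2:ℝ) ^ (1 / 3 : ℝ) ≤ 2 ^ (1 : ℝ) :=
          rpow_le_rpow_of_exponent_le (by norm_num) (by norm_num)
      _ = 2 := rpow_one 2
  calc _ ≤ 6 * (A * (2 * R ^ (-(1 / 3) : ℝ))) * r ^ (7 / 3 : ℝ) := by gcongr; exact h1.trans h2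
    _ = _ := by ring

lemma interior_zero : ∃ K, Interior 0 K := by
  obtain ⟨C, hC0, hC⟩ := rep_bound 0
  set D := 72 * C + 1 with hD
  have hD0 : 0 < D := by positivity
  set δ := (2 * D)⁻¹ with hδ
  have hδ0 : 0 < δ := by positivity
  have hDδ : D * δ = 1 / 2 := by rw [hδ]; field_simp
  have hδ1 : δ ≤ 1 := inv_le_one_of_one_le₀ (by linarith)
  obtain ⟨N, hN⟩ := exists_le_pow (C := 2 * δ⁻¹ ^ 3)
  refine ⟨N + 3, fun u q A h t' ρ' x' hρ ht0 ht1 hρR => ?_⟩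
  set R := rr x'
  have hR : 0 < R := by linarith
  have hA : 0 < A := by linarith [h.two_le]
  rcases (UU_nonneg u 0 t' x').eq_or_lt with h0 | h0
  · rw [← h0, mul_zero]; positivity
  obtain ⟨t, x, ρ, hρ0, hρ2, hQ, hf⟩ := exists_good_point (h.sol.continuous_UU 0) (UU_nonneg u 0)
    one_ne_zero hρ h0
  set m := UU u 0 t x
  set p := (ρ / R) ^ (1 / 3 : ℝ)
  have hp1 : p ≤ 1 := rpow_le_one (by positivity) ((div_le_one hR).2 (by linarith)) (by norm_num)
  set σ := ρ * (δ / A) ^ 3 with hσ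
  have hσ0 : 0 < σ := by positivity
  have hσρ : σ ≤ ρ := mul_le_of_le_one_right hρ0.le
    (pow_le_one₀ (by positivity) ((div_le_one hA).2 (by linarith [h.two_le])))
  have hsub : ∀ s ∈ Icc (t - σ ^ 2) t, s ∈ Icc (t - ρ ^ 2) t := fun s hs =>
    ⟨le_trans (by gcongr) hs.1, hs.2⟩
  have h01 : ∀ s ∈ Icc (t - ρ ^ 2) t, s ∈ Icc (0:ℝ) 1 := fun s hs => by
    have := (hQ s hs x (mem_closedBall_self hρ0.le)).1
    exact ⟨by linarith [this.1], by linarith [this.2]⟩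
  have hρs : 0 ≤ ρ ^ 2 := sq_nonneg ρ
  have ht : t ∈ Icc (t - ρ ^ 2) t := ⟨by linarith, le_rfl⟩
  have ht' : t - ρ ^ 2 ∈ Icc (t - ρ ^ 2) t := ⟨le_rfl, by linarith⟩
  have hm0 : 0 ≤ m := UU_nonneg _ _ _ _
  have hRx : R / 2 ≤ rr x := by
    have h1 := (hQ t ht x (mem_closedBall_self hρ0.le)).2.1
    have h2 := rr_le_add_dist x' x
    rw [dist_comm] at h2
    linarith [mem_closedBall.1 h1]
  have hcu : ∀ s, Continuous (u s) := fun s =>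
    h.sol.1.continuous.comp (by fun_prop : Continuous fun y => (s, y))
  have hcomp : ∀ i s y, |comp u i s y| ≤ ‖u s y‖ := fun i s y => abs_coord_le (u s y) i
  set M := A * R ^ (-(1 / 3) : ℝ)
  have hM0 : 0 < M := by positivity
  have hcc : ∀ i s, Continuous (comp u i s) := fun i s => ((h.sol.smJ i).sm s).continuous
  have key : ∀ i, |comp u i t x| ≤
      C * (σ⁻¹ ^ (0 + 3) * (12 * M * σ ^ (7 / 3 : ℝ)) + σ ^ (1 / 3 : ℝ) * (2 * m * (12 * M))) := by
    intro i
    refine hC u q h.sol t σ x hσ0 ?_ (h01 t ht).2 [] [] i rfl _ _ (by positivity) ?_ ?_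
    · have : σ ^ 2 ≤ ρ ^ 2 := by gcongr
      linarith [(h01 _ ht').1]
    · intro s hs
      refine le_trans ?_ (h.integral_le (h01 s (hsub s hs)) hR hRx hσ0)
      refine setIntegral_mono_on ?_ ?_ measurableSet_closedBall fun y _ => hcomp i s y
      · exact (hcc i s).abs.continuousOn.integrableOn_compact (isCompact_closedBall x σ)
      · exact (hcu s).norm.continuousOn.integrableOn_compact (isCompact_closedBall x σ)
    · intro s hs j k r hr hrσ
      calc _ ≤ ∫ y in closedBall x r, 2 * m * ‖u s y‖ := by
            refine setIntegral_mono_on ?_ ?_ measurableSet_closedBall fun y hy => ?_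
            · exact ((hcc j s).mul (hcc k s)).abs.continuousOn.integrableOn_compact
                (isCompact_closedBall x r)
            · exact (continuous_const.mul (hcu s).norm).continuousOn.integrableOn_compact
                (isCompact_closedBall x r)
            · have h1 := (hQ s (hsub s hs) y (closedBall_subset_closedBall (hrσ.trans hσρ) hy)).2.2
              have h2 := h.sol.abs_dL_le_UU j [] rfl s y
              have h3 := hcomp k s y
              simp only [dL, List.nil_append] at h2 ⊢
              rw [abs_mul]
              rw [pow_one] at h1
              exact mul_le_mul (h2.trans h1) h3 (abs_nonneg _) (by positivity)
        _ ≤ 2 * m * (12 * M * r ^ (7 / 3 : ℝ)) := by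
            rw [integral_const_mul]
            gcongr
            exact h.integral_le (h01 s (hsub s hs)) hR hRx hr
        _ = _ := by ring
  have e1 : σ ^ (1 / 3 : ℝ) * M = δ * p := by
    have : σ ^ (1 / 3 : ℝ) = ρ ^ (1 / 3 : ℝ) * (δ / A) := by
      rw [hσ, mul_rpow hρ0.le (by positivity)]
      congr 1
      rw [← rpow_natCast, ← rpow_mul (by positivity)]; norm_num
    calc σ ^ (1 / 3 : ℝ) * M = δ * (ρ ^ (1 / 3 : ℝ) * R ^ (-(1 / 3) : ℝ)) := by
          rw [this]; simp only [M]; field_simp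
      _ = δ * p := by rw [cbrt_mul hρ0 hR]
  have e2 : σ⁻¹ ^ (0 + 3) * σ ^ (7 / 3 : ℝ) = σ⁻¹ * σ ^ (1 / 3 : ℝ) := by
    have : σ ^ (7 / 3 : ℝ) = σ ^ (1 / 3 : ℝ) * σ ^ 2 := by
      rw [← rpow_natCast σ 2, ← rpow_add hσ0]; norm_num
    rw [this, zero_add, inv_pow]; field_simp
  have hm : m ≤ D * (σ⁻¹ * (δ * p) + δ * p * m) := by
    have := UU_le (u := u) (n := 0) (s := t) (y := x) (fun i l hl => by
      rw [List.length_eq_zero_iff.1 hl]; exact key i)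
    have e3 : σ⁻¹ ^ (0 + 3) * (12 * M * σ ^ (7 / 3 : ℝ)) + σ ^ (1 / 3 : ℝ) * (2 * m * (12 * M)) =
        12 * (σ⁻¹ * (δ * p)) + 24 * (δ * p * m) := by
      rw [← e1]
      linear_combination 12 * M * e2
    rw [e3] at this
    have t1 : 0 ≤ σ⁻¹ * (δ * p) := by positivity
    have t2 : 0 ≤ δ * p * m := by positivity
    have := mul_nonneg hC0 t1
    simp only [m] at *
    nlinarith
  have hm2 : m ≤ p * σ⁻¹ := by
    have h1 : D * (σ⁻¹ * (δ * p) + δ * p * m) = 1 / 2 * (σ⁻¹ * p + p * m) := by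
      rw [← hDδ]; ring
    rw [h1] at hm
    have : p * m ≤ m := mul_le_of_le_one_left hm0 hp1
    linarith
  have hp2 : p ≤ (ρ' / R) ^ (1 / 3 : ℝ) := by
    refine rpow_le_rpow (by positivity) ?_ (by norm_num)
    gcongr; linarith
  calc ρ' ^ (0 + 1) * UU u 0 t' x' ≤ (2 * ρ) ^ 1 * m := hf
    _ ≤ (2 * ρ) ^ 1 * (p * σ⁻¹) := by gcongr
    _ = (2 * δ⁻¹ ^ 3) * A ^ 3 * p := by rw [hσ]; field_simp
    _ ≤ A ^ N * A ^ 3 * (ρ' / R) ^ (1 / 3 : ℝ) := by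
        gcongr
        exact hN A h.two_le
    _ = _ := by rw [pow_add]

lemma dL_mul_bound_top {n : ℕ} {f g : E3 → ℝ} (hf : Sm f) (hg : Sm g) {y : E3} {F H B : ℝ}
    (hF : 0 < F) (hH : 0 < H) (hB : 0 ≤ B)
    (hf1 : ∀ l : List (Fin 3), l.length ≤ n → |dL l f y| ≤ F * H ^ l.length)
    (hf2 : ∀ l : List (Fin 3), l.length = n + 1 → |dL l f y| ≤ B)
    (hg1 : ∀ l : List (Fin 3), l.length ≤ n → |dL l g y| ≤ F * H ^ l.length)
    (hg2 : ∀ l : List (Fin 3), l.length = n + 1 → |dL l g y| ≤ B)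
    (l : List (Fin 3)) (hl : l.length = n + 1) :
    |dL l (fun z => f z * g z) y| ≤ 2 ^ (n + 1) * (F ^ 2 * H ^ (n + 1) + F * B) := by
  set a := (H ^ (n + 1) + B / F) ^ (((n + 1 : ℕ) : ℝ)⁻¹) with ha
  have hBF : 0 ≤ B / F := by positivity
  have ha0 : 0 ≤ a := by positivity
  have han : a ^ (n + 1) = H ^ (n + 1) + B / F := rpow_inv_natCast_pow (by positivity) (by omega)
  have hHa : H ≤ a := le_of_pow_le_pow_left₀ (n := n + 1) (by omega) ha0 (by rw [han]; linarith)
  have main : ∀ w : E3 → ℝ, (∀ l : List (Fin 3), l.length ≤ n → |dL l w y| ≤ F * H ^ l.length) →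
      (∀ l : List (Fin 3), l.length = n + 1 → |dL l w y| ≤ B) →
      ∀ l : List (Fin 3), l.length ≤ n + 1 → |dL l w y| ≤ F * a ^ l.length := by
    intro w h1 h2 l hl
    rcases Nat.le_or_eq_of_le_succ hl with h | h
    · exact (h1 l h).trans (by gcongr)
    · refine (h2 l h).trans ?_
      rw [h, han, mul_add, mul_div_cancel₀ _ hF.ne']
      have : 0 < F * H ^ (n + 1) := by positivity
      linarith
  refine (dL_mul_bound hf hg (main f hf1 hf2) (main g hg1 hg2) l hl).trans_eq ?_
  rw [mul_pow, han]
  field_simp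

lemma Interior.mono {n K K' : ℕ} (h : Interior n K) (hK : K ≤ K') : Interior n K' := by
  intro u q A hs t ρ x hρ h1 h2 h3
  refine (h u q A hs t ρ x hρ h1 h2 h3).trans ?_
  have : 0 ≤ rr x := rr_nonneg x
  have := hs.two_le
  gcongr
  linarith

lemma setIntegral_closedBall_le {f : E3 → ℝ} (hf : Continuous f) {x : E3} {r S : ℝ} (hr : 0 ≤ r)
    (hS : 0 ≤ S) (h : ∀ y ∈ closedBall x r, |f y| ≤ S) :
    ∫ y in closedBall x r, |f y| ≤ 5 * S * r ^ 3 := by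
  have hv : volume.real (closedBall x r) ≤ 5 * r ^ 3 := by
    rw [Measure.real, EuclideanSpace.volume_closedBall_fin_three, ← ENNReal.ofReal_pow hr,
      ← ENNReal.ofReal_mul (by positivity), ENNReal.toReal_ofReal (by positivity)]
    have := pi_lt_d2
    nlinarith [pow_nonneg hr 3]
  calc _ ≤ ∫ _y in closedBall x r, S := by
        refine setIntegral_mono_on ?_ ?_ measurableSet_closedBall h
        · exact hf.abs.continuousOn.integrableOn_compact (isCompact_closedBall x r)
        · exact continuousOn_const.integrableOn_compact (isCompact_closedBall x r)
    _ = volume.real (closedBall x r) * S := by simp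
    _ ≤ 5 * r ^ 3 * S := by gcongr
    _ = _ := by ring

/-- The induction step, stated on a cylinder on which lower order derivatives are under control. -/
lemma top_order_le (n : ℕ) : ∃ D, 1 ≤ D ∧ ∀ u q, IsNSSol u q (Icc 0 1) → ∀ (t σ : ℝ) (x : E3),
    0 < σ → σ ^ 2 ≤ t → t ≤ 1 → ∀ F H B : ℝ, 0 < F → 0 < H → 0 ≤ B →
    (∀ s ∈ Icc (t - σ ^ 2) t, ∀ y ∈ closedBall x σ, (∀ i ≤ n, UU u i s y ≤ F * H ^ i) ∧
      UU u (n + 1) s y ≤ B) →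
    UU u (n + 1) t x ≤ D * (σ⁻¹ * (F * H ^ n) + σ * (F ^ 2 * H ^ (n + 1) + F * B)) := by
  obtain ⟨C, hC0, hC⟩ := rep_bound 1
  refine ⟨3 ^ (n + 1 + 1) * (C * (5 * 2 ^ (n + 1))) + 1, by
    have : 0 ≤ 3 ^ (n + 1 + 1) * (C * (5 * 2 ^ (n + 1))) := by positivity
    linarith, ?_⟩
  intro u q h t σ x hσ ht0 ht1 F H B hF hH hB hQ
  set S := 2 ^ (n + 1) * (F ^ 2 * H ^ (n + 1) + F * B) with hS
  have hS0 : 0 ≤ S := by positivity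
  have hsm : ∀ i s, Sm (comp u i s) := fun i s => (h.smJ i).sm s
  have key : ∀ i, ∀ l : List (Fin 3), l.length = n + 1 → |dL l (comp u i t) x| ≤
      C * (5 * (σ⁻¹ * (F * H ^ n)) + 5 * (σ * S)) := by
    intro i l hl
    obtain ⟨e, β, rfl⟩ : ∃ e β, l = [e] ++ β := by
      cases l with
      | nil => simp at hl
      | cons e β => exact ⟨e, β, rfl⟩
    have hβ : β.length = n := by simpa using hl
    refine (hC u q h t σ x hσ ht0 ht1 [e] β i rfl (5 * (F * H ^ n) * σ ^ 3)
      (5 * S * σ ^ (2 / 3 : ℝ)) (by positivity) ?_ ?_).trans_eq ?_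
    · intro s hs
      refine setIntegral_closedBall_le ((hsm i s).dL β).continuous hσ.le (by positivity) ?_
      intro y hy
      exact (h.abs_dL_le_UU i β hβ s y).trans ((hQ s hs y hy).1 n le_rfl)
    · intro s hs j k r hr hrσ
      refine (setIntegral_closedBall_le (S := S) (Sm.dL (.mul (hsm j s) (hsm k s)) _).continuous
        hr.le
        hS0 ?_).trans ?_
      · intro y hy
        have hy' := hQ s hs y (closedBall_subset_closedBall hrσ hy)
        have b1 : ∀ i, ∀ l : List (Fin 3), l.length ≤ n →
            |dL l (comp u i s) y| ≤ F * H ^ l.length := fun i l hl =>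
          (h.abs_dL_le_UU i l rfl s y).trans (hy'.1 _ hl)
        have b2 : ∀ i, ∀ l : List (Fin 3), l.length = n + 1 → |dL l (comp u i s) y| ≤ B :=
          fun i l hl => (h.abs_dL_le_UU i l hl s y).trans hy'.2
        exact dL_mul_bound_top (hsm j s) (hsm k s) hF hH hB (b1 j) (b2 j) (b1 k) (b2 k) _ hl
      · have e1 : r ^ 3 = r ^ (2 / 3 : ℝ) * r ^ (7 / 3 : ℝ) := by
          rw [← rpow_natCast r 3, ← rpow_add hr]; norm_num
        rw [e1, mul_assoc (5 * S)]
        gcongr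
    · have e2 : σ ^ (1 / 3 : ℝ) * σ ^ (2 / 3 : ℝ) = σ := by
        rw [← rpow_add hσ]; norm_num
      have e3 : σ⁻¹ ^ (1 + 3) * σ ^ 3 = σ⁻¹ := by
        rw [pow_succ' σ⁻¹ 3, mul_assoc, ← mul_pow, inv_mul_cancel₀ hσ.ne', one_pow, mul_one]
      linear_combination C * (5 * S) * e2 + C * (5 * (F * H ^ n)) * e3
  refine (UU_le key).trans ?_
  have h1 : σ⁻¹ * (F * H ^ n) ≤ 2 ^ (n + 1) * (σ⁻¹ * (F * H ^ n)) :=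
    le_mul_of_one_le_left (by positivity) (one_le_pow₀ (by norm_num))
  have h2 : 0 ≤ σ⁻¹ * (F * H ^ n) + σ * (F ^ 2 * H ^ (n + 1) + F * B) := by positivity
  calc _ ≤ 3 ^ (n + 1 + 1) * (C * (5 * (2 ^ (n + 1) * (σ⁻¹ * (F * H ^ n))) + 5 * (σ * S))) := by
        gcongr
    _ = 3 ^ (n + 1 + 1) * (C * (5 * 2 ^ (n + 1))) *
        (σ⁻¹ * (F * H ^ n) + σ * (F ^ 2 * H ^ (n + 1) + F * B)) := by rw [hS]; ring
    _ ≤ _ := by rw [add_mul]; linarith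

lemma absorb_le {n : ℕ} {D W δ L P η ρ m : ℝ} (hD0 : 0 < D) (hW1 : 1 ≤ W) (hδ0 : 0 < δ)
    (hL1 : 1 ≤ L) (hP0 : 0 < P) (hP1 : P ≤ 1) (hη0 : 0 < η) (hρ0 : 0 < ρ) (hρ2 : 2 * ρ ≤ η)
    (hm0 : 0 ≤ m) (hDδ : D * δ * W = 1 / 2)
    (hm : m ≤ D * ((ρ * (δ / L))⁻¹ * (L * P * η⁻¹ * η⁻¹ ^ n) + ρ * (δ / L) *
      ((L * P * η⁻¹) ^ 2 * η⁻¹ ^ (n + 1) + L * P * η⁻¹ * (W * m)))) :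
    (2 * ρ) ^ (n + 1 + 1) * m ≤ (4 * D * δ⁻¹ + 1) * (L * L * P) := by
  have hL0 : 0 < L := by linarith
  have hW0 : 0 < W := by linarith
  have hσF : ρ * (δ / L) * (L * P * η⁻¹) ≤ δ := by
    have e : ρ * (δ / L) * (L * P * η⁻¹) = δ * (P * (ρ / η)) := by field_simp
    rw [e]
    have : ρ / η ≤ 1 := (div_le_one hη0).2 (by linarith)
    exact mul_le_of_le_one_right hδ0.le (mul_le_one₀ hP1 (by positivity) this)
  have e1 : (2 * ρ) ^ (n + 1 + 1) * ((ρ * (δ / L))⁻¹ * (L * P * η⁻¹ * η⁻¹ ^ n)) =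
      2 * δ⁻¹ * (L * L * P) * (2 * ρ * η⁻¹) ^ (n + 1) := by
    rw [pow_succ _ (n + 1), mul_pow _ η⁻¹, pow_succ η⁻¹]
    field_simp
  generalize hσ : ρ * (δ / L) = σ at *
  have hσ0 : 0 < σ := by rw [← hσ]; positivity
  have hq : (2 * ρ * η⁻¹) ≤ 1 := by
    rw [← div_eq_mul_inv]
    exact (div_le_one hη0).2 hρ2
  have e2 : (2 * ρ) ^ (n + 1 + 1) * (L * P * η⁻¹ * η⁻¹ ^ (n + 1)) =
      L * P * (2 * ρ * η⁻¹) ^ (n + 1 + 1) := by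
    rw [mul_pow _ η⁻¹]; ring
  have g1 : (2 * ρ * η⁻¹) ^ (n + 1) ≤ 1 := pow_le_one₀ (by positivity) hq
  have g2 : (2 * ρ * η⁻¹) ^ (n + 1 + 1) ≤ 1 := pow_le_one₀ (by positivity) hq
  generalize hG : L * P * η⁻¹ * η⁻¹ ^ (n + 1) = G at *
  have hG0 : 0 < G := by rw [← hG]; positivity
  have t2 : σ * ((L * P * η⁻¹) ^ 2 * η⁻¹ ^ (n + 1) + L * P * η⁻¹ * (W * m)) ≤
      δ * (W * (G + m)) := by
    calc _ = σ * (L * P * η⁻¹) * (G + W * m) := by rw [← hG]; ring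
      _ ≤ δ * (G + W * m) := mul_le_mul_of_nonneg_right hσF (by positivity)
      _ ≤ δ * (W * (G + m)) := mul_le_mul_of_nonneg_left (by nlinarith) hδ0.le
  have t3 : D * (δ * (W * (G + m))) = 1 / 2 * (G + m) := by rw [← hDδ]; ring
  have t4 := mul_le_mul_of_nonneg_left t2 hD0.le
  generalize hY : σ⁻¹ * (L * P * η⁻¹ * η⁻¹ ^ n) = Y at *
  have hm' : m ≤ 2 * D * Y + G := by linarith
  have hLP : L * P ≤ L * L * P := by nlinarith [mul_pos hL0 hP0]
  calc _ ≤ (2 * ρ) ^ (n + 1 + 1) * (2 * D * Y + G) :=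
        mul_le_mul_of_nonneg_left hm' (by positivity)
    _ = 2 * D * ((2 * ρ) ^ (n + 1 + 1) * Y) + (2 * ρ) ^ (n + 1 + 1) * G := by ring
    _ = 2 * D * (2 * δ⁻¹ * (L * L * P) * (2 * ρ * η⁻¹) ^ (n + 1)) +
        L * P * (2 * ρ * η⁻¹) ^ (n + 1 + 1) := by rw [e1, e2]
    _ ≤ 2 * D * (2 * δ⁻¹ * (L * L * P) * 1) + L * P * 1 := by gcongr
    _ ≤ _ := by linarith

lemma interior_succ {n K : ℕ} (hK : ∀ i ≤ n, Interior i K) : ∃ K', Interior (n + 1) K' := by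
  obtain ⟨D, hD1, hD⟩ := top_order_le n
  have hD0 : 0 < D := by linarith
  set W : ℝ := 2 ^ (n + 1 + 1) with hW
  have hW1 : 1 ≤ W := one_le_pow₀ (by norm_num)
  have hW0 : 0 < W := by linarith
  set δ := (2 * D * W)⁻¹ with hδ
  have hδ0 : 0 < δ := by positivity
  have hDδ : D * δ * W = 1 / 2 := by rw [hδ]; field_simp
  have hδ1 : δ ≤ 1 := inv_le_one_of_one_le₀ (by nlinarith [mul_le_mul hD1 hW1 (by norm_num) hD0.le])
  obtain ⟨N, hN⟩ := exists_le_pow (C := W * (4 * D * δ⁻¹ + 1))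
  refine ⟨N + (K + K), fun u q A h t' ρ' x' hρ ht0 ht1 hρR => ?_⟩
  set R := rr x'
  have hR : 0 < R := by linarith
  have hA2 := h.two_le
  have hA : 0 < A := by linarith
  rcases (UU_nonneg u (n + 1) t' x').eq_or_lt with h0 | h0
  · rw [← h0, mul_zero]; positivity
  set η := ρ' / 2 with hη
  have hη0 : 0 < η := by positivity
  obtain ⟨t, x, ρ, hρ0, hρ2, hQ, hf⟩ := exists_good_point (h.sol.continuous_UU (n + 1))
    (UU_nonneg u (n + 1)) (k := n + 1 + 1) (by omega) hη0 h0
  set m := UU u (n + 1) t x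
  have hm0 : 0 ≤ m := UU_nonneg _ _ _ _
  set P := (ρ' / R) ^ (1 / 3 : ℝ)
  have hP0 : 0 < P := by positivity
  have hP1 : P ≤ 1 := rpow_le_one (by positivity) ((div_le_one hR).2 (by linarith)) (by norm_num)
  set L := A ^ K
  have hL1 : 1 ≤ L := one_le_pow₀ (by linarith)
  have hL0 : 0 < L := by linarith
  set F := L * P * η⁻¹ with hF
  have hF0 : 0 < F := by positivity
  have hηρ : η ^ 2 ≤ t' - η ^ 2 := by rw [hη]; nlinarith
  have low : ∀ s ∈ Icc (t' - η ^ 2) t', ∀ y ∈ closedBall x' η, ∀ i ≤ n,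
      UU u i s y ≤ F * η⁻¹ ^ i := by
    intro s hs y hy i hi
    have hRy : R - η ≤ rr y := by
      have h2 := rr_le_add_dist x' y
      rw [dist_comm] at h2
      linarith [mem_closedBall.1 hy]
    have hRy' : ρ' ≤ rr y := by linarith
    have := hK i hi u q A h s η y hη0 (by linarith [hs.1]) (hs.2.trans ht1) (by linarith)
    have hP2 : (η / rr y) ^ (1 / 3 : ℝ) ≤ P := by
      have hy0 : 0 < rr y := by linarith
      refine rpow_le_rpow (by positivity) ?_ (by norm_num)
      rw [div_le_div_iff₀ hy0 hR]
      nlinarith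
    have h3 : η ^ (i + 1) * UU u i s y ≤ L * P := this.trans (by gcongr)
    have e : F * η⁻¹ ^ i = L * P / η ^ (i + 1) := by
      rw [hF, inv_pow, pow_succ]; field_simp
    rw [e, le_div_iff₀ (by positivity)]
    linarith
  set σ := ρ * (δ / L) with hσ
  have hσ0 : 0 < σ := by positivity
  have hσρ : σ ≤ ρ := mul_le_of_le_one_right hρ0.le ((div_le_one hL0).2 (by linarith))
  have hσs : σ ^ 2 ≤ ρ ^ 2 := by gcongr
  have hρs : 0 ≤ ρ ^ 2 := sq_nonneg ρ
  have a1 := (hQ t ⟨by linarith, le_rfl⟩ x (mem_closedBall_self hρ0.le)).1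
  have a2 := (hQ (t - ρ ^ 2) ⟨le_rfl, by linarith⟩ x (mem_closedBall_self hρ0.le)).1
  have hmain := hD u q h.sol t σ x hσ0 (by nlinarith [a2.1]) (a1.2.trans ht1) F η⁻¹ (W * m)
    hF0 (by positivity) (by positivity) (fun s hs y hy => by
      obtain ⟨b1, b2, b3⟩ := hQ s ⟨by linarith [hs.1], hs.2⟩ y (closedBall_subset_closedBall hσρ hy)
      exact ⟨low s b1 y b2, b3⟩)
  have hfin := absorb_le hD0 hW1 hδ0 hL1 hP0 hP1 hη0 hρ0 hρ2 hm0 hDδ hmain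
  calc ρ' ^ (n + 1 + 1) * UU u (n + 1) t' x'
      = W * (η ^ (n + 1 + 1) * UU u (n + 1) t' x') := by
        rw [hη, div_pow, hW]; field_simp
    _ ≤ W * ((2 * ρ) ^ (n + 1 + 1) * m) := mul_le_mul_of_nonneg_left hf hW0.le
    _ ≤ W * ((4 * D * δ⁻¹ + 1) * (L * L * P)) := mul_le_mul_of_nonneg_left hfin hW0.le
    _ = W * (4 * D * δ⁻¹ + 1) * (L * L * P) := by ring
    _ ≤ A ^ N * (L * L * P) := mul_le_mul_of_nonneg_right (hN A hA2) (by positivity)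
    _ = _ := by simp only [L, pow_add]; ring

lemma exists_interior_le (n : ℕ) : ∃ K, ∀ i ≤ n, Interior i K := by
  induction n with
  | zero =>
    obtain ⟨K, hK⟩ := interior_zero
    exact ⟨K, fun i hi => by rwa [Nat.le_zero.1 hi]⟩
  | succ n ih =>
    obtain ⟨K, hK⟩ := ih
    obtain ⟨K', hK'⟩ := interior_succ hK
    refine ⟨max K K', fun i hi => ?_⟩
    rcases Nat.le_or_eq_of_le_succ hi with h | rfl
    · exact (hK i h).mono (le_max_left _ _)
    · exact hK'.mono (le_max_right _ _)

lemma norm_le_sum_abs (v : E3) : ‖v‖ ≤ ∑ i, |v i| := by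
  refine abs_le_of_sq_le_sq' ?_ (by positivity) |>.2
  rw [norm_sq_E3, Fin.sum_univ_three]
  have h0 := abs_nonneg (v 0)
  have h1 := abs_nonneg (v 1)
  have h2 := abs_nonneg (v 2)
  nlinarith [sq_abs (v 0), sq_abs (v 1), sq_abs (v 2), mul_nonneg h0 h1, mul_nonneg h1 h2,
    mul_nonneg h0 h2]

lemma IsNSSol.norm_iteratedFDeriv_le {I : Set ℝ} (h : IsNSSol u q I) (n : ℕ) (t : ℝ) (x : E3) :
    ‖iteratedFDeriv ℝ n (u t) x‖ ≤ UU u n t x := by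
  have hu : ContDiff ℝ (⊤:ℕ∞) (u t) :=
    h.1.comp (by fun_prop : ContDiff ℝ (⊤:ℕ∞) fun y : E3 => (t, y))
  refine ContinuousMultilinearMap.opNorm_le_bound (UU_nonneg u n t x) fun m => ?_
  refine (norm_le_sum_abs _).trans ?_
  rw [UU, Finset.sum_mul]
  refine Finset.sum_le_sum fun i _ => ?_
  have e := (EuclideanSpace.proj i : E3 →L[ℝ] ℝ).iteratedFDeriv_comp_left
    (x := x) hu.contDiffAt (i := n) (mod_cast le_top)
  have e2 : iteratedFDeriv ℝ n (u t) x m i = iteratedFDeriv ℝ n (comp u i t) x m :=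
    (congrArg (fun z => z m) e).symm
  rw [e2, ← Real.norm_eq_abs]
  refine (ContinuousMultilinearMap.le_opNorm _ m).trans ?_
  gcongr
  exact norm_iteratedFDeriv_le_Nn ((h.smJ i).sm t) n x

lemma exists_deriv_bound (j : ℕ) : ∃ N : ℕ, ∀ u q A, AxiSol u q A → ∀ t ∈ Icc (1 / 2 : ℝ) 1,
    ∀ x, 0 < rr x → (rr x ≤ 1 → UU u j t x ≤ A ^ N * rr x ^ (-1 - (j:ℝ))) ∧
      (1 ≤ rr x → UU u j t x ≤ A ^ N * rr x ^ (-1 / 3 : ℝ)) := by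
  obtain ⟨K, hK⟩ := exists_interior_le j
  refine ⟨(j + 1) + K, fun u q A h t ht x hx => ?_⟩
  have hA2 := h.two_le
  have hA : 0 < A := by linarith
  have h2A : (2:ℝ) ^ (j + 1) ≤ A ^ (j + 1) := by gcongr
  have key : ∀ ρ, 0 < ρ → ρ ≤ 1 / 2 → 2 * ρ ≤ rr x →
      (2 * ρ) ^ (j + 1) * UU u j t x ≤ A ^ (j + 1 + K) * (ρ / rr x) ^ (1 / 3 : ℝ) := by
    intro ρ h0 h1 h2
    have := hK j le_rfl u q A h t ρ x h0 (by nlinarith [ht.1]) ht.2 h2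
    calc _ = 2 ^ (j + 1) * (ρ ^ (j + 1) * UU u j t x) := by ring
      _ ≤ A ^ (j + 1) * (A ^ K * (ρ / rr x) ^ (1 / 3 : ℝ)) := by
          gcongr
          exact mul_nonneg (by positivity) (UU_nonneg u j t x)
      _ = _ := by ring
  constructor
  · intro h1
    have := key (rr x / 2) (by positivity) (by linarith) (by linarith)
    have e1 : (rr x / 2 / rr x) ^ (1 / 3 : ℝ) ≤ 1 :=
      rpow_le_one (by positivity) (by rw [div_le_one hx]; linarith) (by norm_num)
    have e2 : rr x ^ (-1 - (j:ℝ)) = (rr x ^ (j + 1))⁻¹ := by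
      rw [← rpow_natCast, ← rpow_neg hx.le]; push_cast; ring_nf
    rw [e2, ← div_eq_mul_inv, le_div_iff₀ (by positivity)]
    rw [mul_div_cancel₀ _ two_ne_zero] at this
    calc _ = rr x ^ (j + 1) * UU u j t x := mul_comm _ _
      _ ≤ A ^ (j + 1 + K) * 1 := this.trans (by gcongr)
      _ = _ := mul_one _
  · intro h1
    have := key (1 / 2) (by norm_num) le_rfl (by linarith)
    rw [mul_one_div_cancel two_ne_zero, one_pow, one_mul] at this
    refine this.trans ?_
    gcongr
    have e : rr x ^ (-1 / 3 : ℝ) = (1 / rr x) ^ (1 / 3 : ℝ) := by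
      rw [neg_div, rpow_neg hx.le, one_div (rr x), inv_rpow hx.le]
    rw [e]
    gcongr
    norm_num

lemma lintegral_norm_rpow_le {U : E3 → E3} (hU : Continuous U) (hA : 0 ≤ A)
    (h : wnorm3 U ≤ ENNReal.ofReal A) {S : Set E3} {M : ℝ} (hM : 0 < M)
    (hUM : ∀ x ∈ S, ‖U x‖ ≤ M) {p : ℝ} (hp : 3 < p) :
    ∫⁻ x in S, ENNReal.ofReal (‖U x‖ ^ p) ≤ ENNReal.ofReal (p / (p - 3) * A ^ 3 * M ^ (p - 3)) := by
  have hp0 : 0 < p := by linarith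
  rw [lintegral_rpow_eq_lintegral_meas_le_mul _ (Eventually.of_forall fun _ => norm_nonneg _)
    hU.norm.aemeasurable hp0]
  have hint : ∫⁻ t in Ioc 0 M, ENNReal.ofReal (A ^ 3 * t ^ (p - 4)) =
      ENNReal.ofReal (A ^ 3 * M ^ (p - 3) / (p - 3)) := by
    have hi : IntervalIntegrable (fun t : ℝ => A ^ 3 * t ^ (p - 4)) volume 0 M :=
      (intervalIntegral.intervalIntegrable_rpow' (by linarith)).const_mul _
    rw [← ofReal_integral_eq_lintegral_ofReal ((intervalIntegrable_iff_integrableOn_Ioc_of_le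
      hM.le).1 hi), ← intervalIntegral.integral_of_le hM.le, intervalIntegral.integral_const_mul,
      integral_rpow (Or.inl (by linarith)), show p - 4 + 1 = p - 3 by ring,
      zero_rpow (by linarith), sub_zero, mul_div_assoc]
    refine (ae_restrict_iff' measurableSet_Ioc).2 (Eventually.of_forall fun t ht => ?_)
    have := ht.1
    simp only [Pi.zero_apply]
    positivity
  have hle : ∫⁻ t in Ioi 0, (volume.restrict S) {x | t ≤ ‖U x‖} * ENNReal.ofReal (t ^ (p - 1)) ≤
      ∫⁻ t in Ioc 0 M, ENNReal.ofReal (A ^ 3 * t ^ (p - 4)) := by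
    have hss : Ioc 0 M ⊆ Ioi (0:ℝ) := fun t ht => ht.1
    rw [← inter_eq_self_of_subset_left hss, ← setLIntegral_indicator measurableSet_Ioc]
    refine setLIntegral_mono' measurableSet_Ioi fun t ht => ?_
    have ht : 0 < t := ht
    by_cases htM : t ≤ M
    · rw [indicator_of_mem (show t ∈ Ioc 0 M from ⟨ht, htM⟩)]
      calc _ ≤ ENNReal.ofReal (A ^ 3 * t⁻¹ ^ 3) * ENNReal.ofReal (t ^ (p - 1)) := by
            gcongr
            exact (Measure.restrict_apply_le S _).trans (meas_le_of_wnorm3 hA h ht)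
        _ = _ := by
            rw [← ENNReal.ofReal_mul (by positivity)]
            congr 1
            have : t ^ (p - 1) = t ^ (p - 4) * t ^ 3 := by
              rw [← rpow_natCast t 3, ← rpow_add ht]
              congr 1
              push_cast; ring
            rw [this, inv_pow]; field_simp
    · have : (volume.restrict S) {x | t ≤ ‖U x‖} = 0 := by
        rw [Measure.restrict_apply (isClosed_le continuous_const hU.norm).measurableSet]
        refine measure_mono_null (t := ∅) (fun x hx => ?_) measure_empty
        exact absurd (hx.1.trans (hUM x hx.2)) htM
      rw [this, zero_mul]
      exact zero_le
  calc _ ≤ ENNReal.ofReal p * ENNReal.ofReal (A ^ 3 * M ^ (p - 3) / (p - 3)) := by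
        gcongr
        exact hle.trans_eq hint
    _ = _ := by
        rw [← ENNReal.ofReal_mul hp0.le]
        congr 1
        ring

lemma continuous_rr : Continuous rr := by
  unfold rr
  fun_prop

lemma exists_eLpNorm_bound {N : ℕ} {p : ℝ≥0∞} (hp : 3 < p) : ∃ Cp : ℝ, 0 < Cp ∧
    ∀ (A : ℝ) (U : E3 → E3), 2 ≤ A → Continuous U → wnorm3 U ≤ ENNReal.ofReal A →
      (∀ x, 1 ≤ rr x → ‖U x‖ ≤ A ^ N) →
      eLpNorm U p (volume.restrict {x : E3 | 1 ≤ rr x}) ≤ ENNReal.ofReal (A ^ Cp) := by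
  have hS : MeasurableSet {x : E3 | 1 ≤ rr x} :=
    (isClosed_le continuous_const continuous_rr).measurableSet
  rcases eq_or_ne p ⊤ with rfl | hpt
  · refine ⟨N + 1, by positivity, fun A U hA hU hw hb => ?_⟩
    rw [eLpNorm_exponent_top]
    refine eLpNormEssSup_le_of_ae_bound ?_
    refine (ae_restrict_iff' hS).2 (Eventually.of_forall fun x hx => (hb x hx).trans ?_)
    rw [← rpow_natCast]
    exact rpow_le_rpow_of_exponent_le (by linarith) (by linarith)
  · set r := p.toReal with hr
    have hr3 : 3 < r := by
      have := (ENNReal.toReal_lt_toReal (by simp) hpt).2 hp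
      simpa using this
    obtain ⟨n, hn⟩ := exists_le_pow (C := r / (r - 3))
    set E : ℝ := n + 3 + N * (r - 3)
    have hE : 0 < E := by
      have : 0 ≤ (N:ℝ) * (r - 3) := mul_nonneg (by positivity) (by linarith)
      positivity
    refine ⟨E * (1 / r), by positivity, fun A U hA hU hw hb => ?_⟩
    have hA0 : 0 < A := by linarith
    have hp0 : p ≠ 0 := (lt_trans (by simp) hp).ne'
    have key := lintegral_norm_rpow_le hU hA0.le hw (pow_pos hA0 N) hb hr3
    rw [eLpNorm_eq_lintegral_rpow_enorm_toReal hp0 hpt, rpow_mul hA0.le,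
      ← ENNReal.ofReal_rpow_of_nonneg (by positivity) (by positivity), ← hr]
    gcongr
    have e : ∀ x, ‖U x‖ₑ ^ r = ENNReal.ofReal (‖U x‖ ^ r) := fun x => by
      rw [← ofReal_norm, ENNReal.ofReal_rpow_of_nonneg (norm_nonneg _) (by linarith)]
    simp only [e]
    refine key.trans (ENNReal.ofReal_le_ofReal ?_)
    calc _ ≤ A ^ n * A ^ 3 * (A ^ N) ^ (r - 3) := by
          gcongr
          exact hn A hA
      _ = A ^ E := by
          rw [← rpow_natCast A N, ← rpow_mul hA0.le, ← rpow_natCast A n, ← rpow_natCast A 3,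
            ← rpow_add hA0, ← rpow_add hA0]
          norm_num [E]

end

/-- Pointwise bounds away from the axis. -/
theorem stmt10 (ε : ℝ) (hε : ε ∈ Set.Ioo (0:ℝ) (4 / 15)) (j : ℕ) :
    ∃ C : ℝ, 0 < C ∧
      ∀ p : ℝ≥0∞, 3 < p →
        ∃ Cp : ℝ, 0 < Cp ∧
          ∀ A : ℝ, 2 ≤ A →
            ∀ (u : ℝ → E3 → E3) (π' : ℝ → E3 → ℝ),
              IsNSSol u π' (Set.Icc 0 1) → AxiSym u →
              (∀ t ∈ Set.Icc (0:ℝ) 1, wnorm3 (u t) ≤ ENNReal.ofReal A) →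
              ∀ t ∈ Set.Icc (1/2 : ℝ) 1,
                (∀ x : E3, 0 < rr x →
                  ‖iteratedFDeriv ℝ j (u t) x‖ ≤
                    (rr x ^ (-1 - (j:ℝ)) + rr x ^ (-1/3 + ε)) * A ^ C) ∧
                eLpNorm (u t) p (volume.restrict {x : E3 | 1 ≤ rr x}) ≤
                  ENNReal.ofReal (A ^ Cp) := by
  obtain ⟨hε0, -⟩ := hε
  obtain ⟨N, hN⟩ := exists_deriv_bound j
  obtain ⟨N₀, hN₀⟩ := exists_deriv_bound 0
  refine ⟨N + 1, by positivity, fun p hp => ?_⟩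
  obtain ⟨Cp, hCp, hb⟩ := exists_eLpNorm_bound (N := N₀) hp
  refine ⟨Cp, hCp, fun A hA u q hu hax hw t ht => ?_⟩
  have hsol : AxiSol u q A := ⟨hA, hu, hax, hw⟩
  refine ⟨fun x hx => (hu.norm_iteratedFDeriv_le j t x).trans ?_, ?_⟩
  · have hAN : A ^ N ≤ A ^ ((N:ℝ) + 1) := by
      rw [← rpow_natCast]
      exact rpow_le_rpow_of_exponent_le (by linarith) (by linarith)
    have h1 : 0 ≤ rr x ^ (-1 - (j:ℝ)) := by positivity
    have h2 : 0 ≤ rr x ^ (-1/3 + ε) := by positivity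
    obtain ⟨b1, b2⟩ := hN u q A hsol t ht x hx
    rw [mul_comm]
    rcases le_total (rr x) 1 with h | h
    · refine (b1 h).trans ?_
      gcongr
      linarith
    · refine (b2 h).trans ?_
      gcongr
      have : rr x ^ (-1/3 : ℝ) ≤ rr x ^ (-1/3 + ε) :=
        rpow_le_rpow_of_exponent_le h (by linarith)
      linarith
  · refine hb A (u t) hA (hu.1.continuous.comp (by fun_prop : Continuous fun y => (t, y)))
      (hw t ⟨by linarith [ht.1], ht.2⟩) fun x hx => ?_
    have h0 := hu.norm_iteratedFDeriv_le 0 t x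
    rw [norm_iteratedFDeriv_zero] at h0
    refine h0.trans (((hN₀ u q A hsol t ht x (by linarith)).2 hx).trans ?_)
    exact mul_le_of_le_one_right (by positivity) (rpow_le_one_of_one_le_of_nonpos hx (by norm_num))
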